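/- arXiv:1505.05855 — 13 statements merged into one kernel-verified Lean document; each statement's English description precedes it below -/
import Mathlib

section
/- For every integer n ≥ 0 and every function f : {0,1,…,3^{n+1}} → ℝ, one has E_{n+1}(f) ≥ E_n(k ↦ f(3k)). Moreover, equality E_{n+1}(f) = E_n(k ↦ f(3k)) holds whenever f is the harmonic extension of its restriction, i.e. whenever f(3k+1) = (f(3k) + p·f(3k+3))/(1+p) and f(3k+2) = (f(3k+3) + p·f(3k))/(1+p) for all 0 ≤ k < 3^n. -/
noncomputable section

/-- Level-`n` conductances: `c_{0,0} = 1`,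
`c_{n+1,3k} = c_{n+1,3k+2} = ((1+p)/p)·c_{n,k}`, `c_{n+1,3k+1} = ((1+p)/(1-p))·c_{n,k}`. -/
def cnd (p : ℝ) : ℕ → ℕ → ℝ
  | 0, _ => 1
  | n + 1, k =>
    if k % 3 = 1 then ((1 + p) / (1 - p)) * cnd p n (k / 3)
    else ((1 + p) / p) * cnd p n (k / 3)

/-- Level-`n` discrete Dirichlet energy `E_n(f) = Σ_{k<3^n} c_{n,k} (f(k+1) - f(k))²`. -/
def energy (p : ℝ) (n : ℕ) (f : ℕ → ℝ) : ℝ :=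
  ∑ k ∈ Finset.range (3 ^ n), cnd p n k * (f (k + 1) - f k) ^ 2

theorem cnd_nonneg {p : ℝ} (hp0 : 0 < p) (hp1 : p < 1) (n k : ℕ) : 0 ≤ cnd p n k := by
  have hq : 0 < 1 - p := sub_pos.2 hp1
  induction n generalizing k with
  | zero => simp [cnd]
  | succ n ih =>
    have h := ih (k / 3)
    rw [cnd]
    split_ifs <;> positivity

theorem sum_range_three_mul {M : Type*} [AddCommMonoid M] (g : ℕ → M) (m : ℕ) :
    ∑ k ∈ Finset.range (3 * m), g k =
      ∑ k ∈ Finset.range m, (g (3 * k) + g (3 * k + 1) + g (3 * k + 2)) := by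
  induction m with
  | zero => simp
  | succ m ih =>
    rw [Nat.mul_succ, Finset.sum_range_succ, Finset.sum_range_succ, Finset.sum_range_succ, ih,
      Finset.sum_range_succ]
    simp only [add_assoc]

theorem energy_succ (p : ℝ) (n : ℕ) (f : ℕ → ℝ) :
    energy p (n + 1) f = ∑ k ∈ Finset.range (3 ^ n), cnd p n k *
      ((1 + p) / p * (f (3 * k + 1) - f (3 * k)) ^ 2 +
        (1 + p) / (1 - p) * (f (3 * k + 2) - f (3 * k + 1)) ^ 2 +
        (1 + p) / p * (f (3 * k + 3) - f (3 * k + 2)) ^ 2) := by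
  rw [energy, pow_succ', sum_range_three_mul]
  refine Finset.sum_congr rfl fun k _ => ?_
  have h0 : cnd p (n + 1) (3 * k) = (1 + p) / p * cnd p n k := by
    rw [cnd, if_neg (by omega), show 3 * k / 3 = k by omega]
  have h1 : cnd p (n + 1) (3 * k + 1) = (1 + p) / (1 - p) * cnd p n k := by
    rw [cnd, if_pos (by omega), show (3 * k + 1) / 3 = k by omega]
  have h2 : cnd p (n + 1) (3 * k + 2) = (1 + p) / p * cnd p n k := by
    rw [cnd, if_neg (by omega), show (3 * k + 2) / 3 = k by omega]
  rw [h0, h1, h2]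
  ring

/-- The energy of three edges in series exceeds that of the single edge they refine by a weighted
sum of squares, which vanishes at the harmonic extension. -/
theorem cell_energy_eq {p : ℝ} (hp0 : 0 < p) (hp1 : p < 1) (a b c d : ℝ) :
    (1 + p) / p * (b - a) ^ 2 + (1 + p) / (1 - p) * (c - b) ^ 2 + (1 + p) / p * (d - c) ^ 2 =
      (d - a) ^ 2 + ((1 + p) / p * (b - (a + p * d) / (1 + p)) ^ 2 +
        (1 + p) / (1 - p) *
          ((c - (d + p * a) / (1 + p)) - (b - (a + p * d) / (1 + p))) ^ 2 +
        (1 + p) / p * (c - (d + p * a) / (1 + p)) ^ 2) := by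
  have hp : p ≠ 0 := hp0.ne'
  have hq : 1 - p ≠ 0 := (sub_pos.2 hp1).ne'
  have hs : 1 + p ≠ 0 := by positivity
  field_simp
  ring

/-- `E_{n+1}(f) ≥ E_n(k ↦ f(3k))`, with equality when `f` is the harmonic extension of its
restriction. -/
theorem stmt0 (p : ℝ) (hp0 : 0 < p) (hp1 : p < 1) (n : ℕ) (f : ℕ → ℝ) :
    energy p n (fun k => f (3 * k)) ≤ energy p (n + 1) f ∧
    ((∀ k < 3 ^ n,
        f (3 * k + 1) = (f (3 * k) + p * f (3 * k + 3)) / (1 + p) ∧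
        f (3 * k + 2) = (f (3 * k + 3) + p * f (3 * k)) / (1 + p)) →
      energy p (n + 1) f = energy p n (fun k => f (3 * k))) := by
  have hq : 0 < 1 - p := sub_pos.2 hp1
  rw [energy_succ, energy]
  constructor
  · refine Finset.sum_le_sum fun k _ => mul_le_mul_of_nonneg_left ?_ (cnd_nonneg hp0 hp1 n k)
    rw [cell_energy_eq hp0 hp1]
    exact le_add_of_nonneg_right (by positivity)
  · intro h
    refine Finset.sum_congr rfl fun k hk => ?_
    obtain ⟨h1, h2⟩ := h k (Finset.mem_range.1 hk)
    rw [cell_energy_eq hp0 hp1, ← h1, ← h2]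
    simp [mul_add]
end
end

section
/- Let n ≥ 0 and let z ∈ ℂ with z ∉ {1−p, 1+p}. Then z is an eigenvalue of Δ_{n+1} (acting on ℂ^{3^{n+1}+1}) if and only if R(z) is an eigenvalue of Δ_n (acting on ℂ^{3^n+1}), and in that case the dimensions of the eigenspace of Δ_{n+1} for z and of the eigenspace of Δ_n for R(z) are equal. -/
noncomputable section

/-- Transition coefficients `a_{n,k}`: `a_{n+1,3k} = a_{n,k}`, `a_{n+1,3k+1} = q = 1-p`,
`a_{n+1,3k+2} = p`. -/
def a (p : ℝ) : ℕ → ℕ → ℝ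
  | 0, _ => 0
  | n + 1, k =>
    if k % 3 = 1 then 1 - p
    else if k % 3 = 2 then p
    else a p n (k / 3)

/-- The Neumann discrete Laplacian `Δ_n` acting on complex-valued functions.  -/
def lapC (p : ℝ) (n : ℕ) (f : ℕ → ℂ) (k : ℕ) : ℂ :=
  if k = 0 then f 0 - f 1
  else if k = 3 ^ n then f (3 ^ n) - f (3 ^ n - 1)
  else f k - (a p n k : ℂ) * f (k - 1) - (1 - (a p n k : ℂ)) * f (k + 1)

/-- Extension of a vector in `ℂ^{3^n+1}` to a function on `ℕ` (zero outside). -/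
def toFun (n : ℕ) (g : Fin (3 ^ n + 1) → ℂ) : ℕ → ℂ :=
  fun j => if h : j < 3 ^ n + 1 then g ⟨j, h⟩ else 0

lemma lapC_add (p : ℝ) (n : ℕ) (u v : ℕ → ℂ) (k : ℕ) :
    lapC p n (fun j => u j + v j) k = lapC p n u k + lapC p n v k := by
  simp only [lapC]; split_ifs <;> ring

lemma lapC_smul (p : ℝ) (n : ℕ) (c : ℂ) (u : ℕ → ℂ) (k : ℕ) :
    lapC p n (fun j => c * u j) k = c * lapC p n u k := by
  simp only [lapC]; split_ifs <;> ring

lemma toFun_add (n : ℕ) (g h : Fin (3 ^ n + 1) → ℂ) :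
    toFun n (g + h) = fun j => toFun n g j + toFun n h j := by
  funext j; simp only [toFun, Pi.add_apply]; split_ifs <;> simp

lemma toFun_smul (n : ℕ) (c : ℂ) (g : Fin (3 ^ n + 1) → ℂ) :
    toFun n (c • g) = fun j => c * toFun n g j := by
  funext j; simp only [toFun, Pi.smul_apply, smul_eq_mul]; split_ifs <;> simp

/-- The eigenspace of the Neumann discrete Laplacian `Δ_n` (acting on `ℂ^{3^n+1}`)
for the (candidate) eigenvalue `z`. -/
def eigSp (p : ℝ) (n : ℕ) (z : ℂ) : Submodule ℂ (Fin (3 ^ n + 1) → ℂ) where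
  carrier := {g | ∀ k ≤ 3 ^ n, lapC p n (toFun n g) k = z * toFun n g k}
  add_mem' := by
    intro g h hg hh k hk
    simp only [toFun_add, lapC_add, hg k hk, hh k hk]
    ring
  zero_mem' := by
    intro k hk
    have h0 : toFun n (0 : Fin (3 ^ n + 1) → ℂ) = fun _ => 0 := by
      funext j; simp [toFun]
    rw [h0]
    simp [lapC]
  smul_mem' := by
    intro c g hg k hk
    simp only [toFun_smul, lapC_smul, hg k hk]
    ring

/-- The cubic polynomial `R(z) = z(z² − 3z + 2 + pq)/(pq)`, over `ℂ`. -/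
def RC (p : ℝ) (z : ℂ) : ℂ :=
  z * (z ^ 2 - 3 * z + 2 + (p : ℂ) * (1 - (p : ℂ))) / ((p : ℂ) * (1 - (p : ℂ)))
lemma a_succ_three_mul (p : ℝ) (n k : ℕ) : a p (n + 1) (3 * k) = a p n k := by
  simp [a]

lemma a_succ_three_mul_add_one (p : ℝ) (n k : ℕ) : a p (n + 1) (3 * k + 1) = 1 - p := by
  simp [a, Nat.add_mod]

lemma a_succ_three_mul_add_two (p : ℝ) (n k : ℕ) : a p (n + 1) (3 * k + 2) = p := by
  simp [a, Nat.add_mod]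

/-- The values of `G` inside each cell `[3k, 3k+3]` are the `z`-harmonic interpolation of its
values at the two endpoints of the cell. -/
def IsInterp (p : ℝ) (n : ℕ) (z : ℂ) (G : ℕ → ℂ) : Prop :=
  ∀ k < 3 ^ n,
    G (3 * k + 1) =
      (1 - p) * ((1 - z) * G (3 * k) + p * G (3 * (k + 1))) / ((1 - z) ^ 2 - p ^ 2) ∧
    G (3 * k + 2) =
      (1 - p) * (p * G (3 * k) + (1 - z) * G (3 * (k + 1))) / ((1 - z) ^ 2 - p ^ 2)

lemma interp_iff {p z u x y v : ℂ} (hD : (1 - z) ^ 2 - p ^ 2 ≠ 0) :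
    (x - (1 - p) * u - (1 - (1 - p)) * y = z * x ∧ y - p * x - (1 - p) * v = z * y) ↔
    (x = (1 - p) * ((1 - z) * u + p * v) / ((1 - z) ^ 2 - p ^ 2) ∧
      y = (1 - p) * (p * u + (1 - z) * v) / ((1 - z) ^ 2 - p ^ 2)) := by
  rw [eq_div_iff hD, eq_div_iff hD]
  constructor
  · rintro ⟨h1, h2⟩
    exact ⟨by linear_combination (1 - z) * h1 + p * h2, by linear_combination p * h1 + (1 - z) * h2⟩
  · rintro ⟨h1, h2⟩
    exact ⟨mul_left_cancel₀ hD (by linear_combination (1 - z) * h1 - p * h2),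
      mul_left_cancel₀ hD (by linear_combination (1 - z) * h2 - p * h1)⟩

lemma lapC_succ_three_mul_add_one (p : ℝ) (n : ℕ) (G : ℕ → ℂ) {k : ℕ} :
    lapC p (n + 1) G (3 * k + 1) =
      G (3 * k + 1) - (1 - p) * G (3 * k) - (1 - (1 - p)) * G (3 * k + 2) := by
  have h : 3 * k + 1 ≠ 3 ^ (n + 1) := by rw [pow_succ]; omega
  simp [lapC, h, a_succ_three_mul_add_one]

lemma lapC_succ_three_mul_add_two (p : ℝ) (n : ℕ) (G : ℕ → ℂ) {k : ℕ} :
    lapC p (n + 1) G (3 * k + 2) =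
      G (3 * k + 2) - p * G (3 * k + 1) - (1 - p) * G (3 * (k + 1)) := by
  have h : 3 * k + 2 ≠ 3 ^ (n + 1) := by rw [pow_succ]; omega
  simp [lapC, h, a_succ_three_mul_add_two, mul_add]

lemma lapC_succ_three_mul_sub {p : ℝ} (hp0 : (p : ℂ) ≠ 0) (hp1 : 1 - (p : ℂ) ≠ 0) {n : ℕ} {z : ℂ}
    (hD : (1 - z) ^ 2 - (p : ℂ) ^ 2 ≠ 0) {G : ℕ → ℂ} (hG : IsInterp p n z G) {k : ℕ}
    (hk : k ≤ 3 ^ n) :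
    lapC p (n + 1) G (3 * k) - z * G (3 * k) =
      (1 - p) * p / ((1 - z) ^ 2 - (p : ℂ) ^ 2) *
        (lapC p n (fun j => G (3 * j)) k - RC p z * G (3 * k)) := by
  have hpos : 0 < 3 ^ n := by positivity
  rcases k with _ | k
  · have h := (hG 0 hpos).1
    simp only [mul_zero, zero_add] at h
    simp only [lapC, mul_zero, if_true, RC, h]
    field_simp
    ring
  · have h2 := (hG k (by omega)).2
    have e : 3 * (k + 1) - 1 = 3 * k + 2 := by omega
    rcases hk.eq_or_lt with hk | hk
    · have hk' : 3 * (k + 1) = 3 ^ (n + 1) := by rw [pow_succ]; omega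
      simp only [lapC, ← hk', ← hk, if_true, RC, e, Nat.add_sub_cancel, h2,
        Nat.mul_eq_zero, Nat.succ_ne_zero, or_self, if_false, OfNat.ofNat_ne_zero]
      field_simp
      ring
    · have hk' : 3 * (k + 1) ≠ 3 ^ (n + 1) := by rw [pow_succ]; omega
      have h1 := (hG (k + 1) hk).1
      simp only [lapC, hk', hk.ne, RC, e, Nat.add_sub_cancel, h1, h2, a_succ_three_mul,
        Nat.mul_eq_zero, Nat.succ_ne_zero, or_self, if_false, OfNat.ofNat_ne_zero]
      field_simp
      ring

lemma eigen_succ_iff {p : ℝ} (hp0 : (p : ℂ) ≠ 0) (hp1 : 1 - (p : ℂ) ≠ 0) {n : ℕ} {z : ℂ}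
    (hD : (1 - z) ^ 2 - (p : ℂ) ^ 2 ≠ 0) (G : ℕ → ℂ) :
    (∀ k ≤ 3 ^ (n + 1), lapC p (n + 1) G k = z * G k) ↔
      IsInterp p n z G ∧
        ∀ k ≤ 3 ^ n, lapC p n (fun j => G (3 * j)) k = RC p z * G (3 * k) := by
  have hiff : IsInterp p n z G → ∀ k ≤ 3 ^ n,
      (lapC p (n + 1) G (3 * k) = z * G (3 * k) ↔
        lapC p n (fun j => G (3 * j)) k = RC p z * G (3 * k)) := fun hG k hk => by
    rw [← sub_eq_zero, lapC_succ_three_mul_sub hp0 hp1 hD hG hk, mul_eq_zero,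
      or_iff_right (div_ne_zero (mul_ne_zero hp1 hp0) hD), sub_eq_zero]
  have hpow : 3 ^ (n + 1) = 3 * 3 ^ n := pow_succ' 3 n
  constructor
  · intro h
    have hG : IsInterp p n z G := fun k hk => (interp_iff hD).1
      ⟨by rw [← lapC_succ_three_mul_add_one]; exact h _ (by omega),
        by rw [← lapC_succ_three_mul_add_two p n]; exact h _ (by omega)⟩
    exact ⟨hG, fun k hk => (hiff hG k hk).1 (h _ (by omega))⟩
  · rintro ⟨hG, h⟩ m hm
    obtain ⟨k, rfl | rfl | rfl⟩ : ∃ k, m = 3 * k ∨ m = 3 * k + 1 ∨ m = 3 * k + 2 :=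
      ⟨m / 3, by omega⟩
    · exact (hiff hG k (by omega)).2 (h k (by omega))
    · rw [lapC_succ_three_mul_add_one]
      exact ((interp_iff hD).2 (hG k (by omega))).1
    · rw [lapC_succ_three_mul_add_two]
      exact ((interp_iff hD).2 (hG k (by omega))).2

/-- Restriction of a vector to the multiples of three. -/
def restrictThree (n : ℕ) : (Fin (3 ^ (n + 1) + 1) → ℂ) →ₗ[ℂ] (Fin (3 ^ n + 1) → ℂ) :=
  LinearMap.funLeft ℂ ℂ fun i => ⟨3 * i, by have := i.2; rw [pow_succ]; omega⟩

lemma toFun_restrictThree (n : ℕ) (g : Fin (3 ^ (n + 1) + 1) → ℂ) :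
    toFun n (restrictThree n g) = fun j => toFun (n + 1) g (3 * j) := by
  funext j
  have : 3 * j < 3 ^ (n + 1) + 1 ↔ j < 3 ^ n + 1 := by rw [pow_succ]; omega
  simp only [toFun, this]
  rfl

/-- The `z`-harmonic interpolation of `F`. -/
def interpolate (p : ℝ) (z : ℂ) (F : ℕ → ℂ) (m : ℕ) : ℂ :=
  if m % 3 = 0 then F (m / 3)
  else if m % 3 = 1 then
    (1 - p) * ((1 - z) * F (m / 3) + p * F (m / 3 + 1)) / ((1 - z) ^ 2 - p ^ 2)
  else (1 - p) * (p * F (m / 3) + (1 - z) * F (m / 3 + 1)) / ((1 - z) ^ 2 - p ^ 2)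

lemma interpolate_three_mul (p : ℝ) (z : ℂ) (F : ℕ → ℂ) (k : ℕ) :
    interpolate p z F (3 * k) = F k := by
  simp [interpolate]

lemma toFun_of_le {n m : ℕ} (H : ℕ → ℂ) (hm : m ≤ 3 ^ n) :
    toFun n (fun i => H i) m = H m := by
  simp [toFun, Nat.lt_succ_of_le hm]

lemma toFun_injective (n : ℕ) : Function.Injective (toFun n) := by
  intro g h hgh
  ext i
  simpa [toFun, i.is_le] using congrFun hgh i

lemma isInterp_toFun_interpolate (p : ℝ) (n : ℕ) (z : ℂ) (F : ℕ → ℂ) :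
    IsInterp p n z (toFun (n + 1) fun i => interpolate p z F i) := by
  intro k hk
  have hpow : 3 ^ (n + 1) = 3 * 3 ^ n := pow_succ' 3 n
  rw [toFun_of_le _ (by omega), toFun_of_le _ (by omega), toFun_of_le _ (by omega),
    toFun_of_le _ (by omega), interpolate_three_mul, interpolate_three_mul]
  have h1 : (3 * k + 1) / 3 = k := by omega
  have h2 : (3 * k + 2) / 3 = k := by omega
  simp [interpolate, Nat.add_mod, h1, h2]

lemma restrictThree_interpolate (p : ℝ) (n : ℕ) (z : ℂ) (f : Fin (3 ^ n + 1) → ℂ) :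
    restrictThree n (fun i => interpolate p z (toFun n f) i) = f := by
  ext i
  change interpolate p z (toFun n f) (3 * i) = f i
  rw [interpolate_three_mul]
  exact dif_pos i.2

lemma IsInterp.ext {p : ℝ} {n : ℕ} {z : ℂ} {g h : Fin (3 ^ (n + 1) + 1) → ℂ}
    (hg : IsInterp p n z (toFun (n + 1) g)) (hh : IsInterp p n z (toFun (n + 1) h))
    (hgh : restrictThree n g = restrictThree n h) : g = h := by
  apply toFun_injective
  have key (j : ℕ) : toFun (n + 1) g (3 * j) = toFun (n + 1) h (3 * j) := by
    rw [← congrFun (toFun_restrictThree n g) j, hgh, toFun_restrictThree]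
  funext m
  by_cases hm : m < 3 ^ (n + 1) + 1
  · have hpow : 3 ^ (n + 1) = 3 * 3 ^ n := pow_succ' 3 n
    obtain ⟨k, rfl | rfl | rfl⟩ : ∃ k, m = 3 * k ∨ m = 3 * k + 1 ∨ m = 3 * k + 2 :=
      ⟨m / 3, by omega⟩
    · exact key k
    · rw [(hg k (by omega)).1, (hh k (by omega)).1, key, key]
    · rw [(hg k (by omega)).2, (hh k (by omega)).2, key, key]
  · simp [toFun, hm]

lemma mem_eigSp_succ_iff {p : ℝ} (hp0 : (p : ℂ) ≠ 0) (hp1 : 1 - (p : ℂ) ≠ 0) {n : ℕ} {z : ℂ}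
    (hD : (1 - z) ^ 2 - (p : ℂ) ^ 2 ≠ 0) (g : Fin (3 ^ (n + 1) + 1) → ℂ) :
    g ∈ eigSp p (n + 1) z ↔
      IsInterp p n z (toFun (n + 1) g) ∧ restrictThree n g ∈ eigSp p n (RC p z) := by
  refine (eigen_succ_iff hp0 hp1 hD _).trans (and_congr_right fun _ => ?_)
  change _ ↔ ∀ k ≤ 3 ^ n, lapC p n (toFun n (restrictThree n g)) k =
    RC p z * toFun n (restrictThree n g) k
  rw [toFun_restrictThree]

lemma finrank_eigSp_succ {p : ℝ} (hp0 : (p : ℂ) ≠ 0) (hp1 : 1 - (p : ℂ) ≠ 0) {n : ℕ} {z : ℂ}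
    (hD : (1 - z) ^ 2 - (p : ℂ) ^ 2 ≠ 0) :
    Module.finrank ℂ (eigSp p (n + 1) z) = Module.finrank ℂ (eigSp p n (RC p z)) := by
  have hmem := mem_eigSp_succ_iff (n := n) hp0 hp1 hD
  refine (LinearEquiv.ofBijective ((restrictThree n).restrict fun g hg => ((hmem g).1 hg).2)
    ⟨fun g h hgh => ?_, fun f => ?_⟩).finrank_eq
  · exact Subtype.ext (((hmem _).1 g.2).1.ext ((hmem _).1 h.2).1 (congrArg Subtype.val hgh))
  · have hf := restrictThree_interpolate p n z f.1
    exact ⟨⟨_, (hmem _).2 ⟨isInterp_toFun_interpolate p n z (toFun n f.1), hf.symm ▸ f.2⟩⟩,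
      Subtype.ext hf⟩

/-- Spectral decimation: for `z ∉ {1−p, 1+p}`, `z` is an eigenvalue of `Δ_{n+1}` iff `R(z)`
is an eigenvalue of `Δ_n`, with equal multiplicities. -/
theorem stmt1 (p : ℝ) (hp0 : 0 < p) (hp1 : p < 1) (n : ℕ) (z : ℂ)
    (hz1 : z ≠ 1 - (p : ℂ)) (hz2 : z ≠ 1 + (p : ℂ)) :
    (eigSp p (n + 1) z ≠ ⊥ ↔ eigSp p n (RC p z) ≠ ⊥) ∧
    Module.finrank ℂ (eigSp p (n + 1) z) = Module.finrank ℂ (eigSp p n (RC p z)) := by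
  have h0 : (p : ℂ) ≠ 0 := by exact_mod_cast hp0.ne'
  have h1 : 1 - (p : ℂ) ≠ 0 := by exact_mod_cast (sub_pos.2 hp1).ne'
  have hD : (1 - z) ^ 2 - (p : ℂ) ^ 2 ≠ 0 := by
    rw [sq_sub_sq]
    exact mul_ne_zero (fun h => hz2 (by linear_combination -h))
      fun h => hz1 (by linear_combination -h)
  have h := finrank_eigSp_succ (n := n) h0 h1 hD
  refine ⟨not_congr ?_, h⟩
  rw [← Submodule.finrank_eq_zero, h, Submodule.finrank_eq_zero]
end
end

section
/- For every n ≥ 0, the operator Δ_n has exactly 3^n + 1 distinct real eigenvalues (simple spectrum). The spectrum satisfies σ(Δ_0) = {0, 2}, and for every n ≥ 1, σ(Δ_n) = {0, 2} ∪ ⋃_{m=0}^{n−1} { z ∈ ℝ : R^{∘m}(z) ∈ {1−q, 1+q} }, where R^{∘m} denotes the m-fold iterate of R. In particular, for all n ≥ 1 one has 0, 1−q, 1+q, 2 ∈ σ(Δ_n); moreover, for n ≥ 1, the numbers 1−p and 1+p belong to σ(Δ_n) if and only if p = 1/2. -/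
noncomputable section

/-- The Neumann discrete Laplacian `Δ_n`. -/
def lap (p : ℝ) (n : ℕ) (f : ℕ → ℝ) (k : ℕ) : ℝ :=
  if k = 0 then f 0 - f 1
  else if k = 3 ^ n then f (3 ^ n) - f (3 ^ n - 1)
  else f k - a p n k * f (k - 1) - (1 - a p n k) * f (k + 1)

/-- The cubic polynomial `R(z) = z(z² − 3z + 2 + pq)/(pq)` with `q = 1 − p`. -/
def R (p z : ℝ) : ℝ := z * (z ^ 2 - 3 * z + 2 + p * (1 - p)) / (p * (1 - p))

/-- `f` is an eigenfunction of `Δ_n` with eigenvalue `z`. -/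
def IsEigen (p : ℝ) (n : ℕ) (z : ℝ) (f : ℕ → ℝ) : Prop :=
  (∃ k ≤ 3 ^ n, f k ≠ 0) ∧ ∀ k ≤ 3 ^ n, lap p n f k = z * f k

/-- The set of real eigenvalues of `Δ_n`. -/
def spec (p : ℝ) (n : ℕ) : Set ℝ := {z | ∃ f, IsEigen p n z f}

/-! ### Algebra of the cubic `R` -/

lemma R_zero (p : ℝ) : R p 0 = 0 := by simp [R]

lemma R_symm (p z : ℝ) : R (1 - p) z = R p z := by
  simp only [R, sub_sub_cancel]
  rw [mul_comm (1 - p) p]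

lemma R_two {p : ℝ} (hp0 : 0 < p) (hp1 : p < 1) : R p 2 = 2 := by
  have hq : 1 - p ≠ 0 := by linarith
  unfold R
  field_simp
  ring

lemma R_self {p : ℝ} (hp0 : 0 < p) (hp1 : p < 1) : R p p = 2 := by
  have hq : 1 - p ≠ 0 := by linarith
  unfold R
  field_simp
  ring

lemma R_one_add_self (p : ℝ) : R p (1 + p) = 0 := by
  have h : (1 + p) ^ 2 - 3 * (1 + p) + 2 + p * (1 - p) = 0 := by ring
  simp [R, h]

lemma R_one_sub_self {p : ℝ} (hp0 : 0 < p) (hp1 : p < 1) : R p (1 - p) = 2 := by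
  rw [← R_symm]
  exact R_self (by linarith) (by linarith)

lemma R_two_sub_self (p : ℝ) : R p (2 - p) = 0 := by
  rw [← R_symm, show 2 - p = 1 + (1 - p) by ring]
  exact R_one_add_self _

lemma iterate_R_eq_zero_or_two {p : ℝ} (hp0 : 0 < p) (hp1 : p < 1) (m : ℕ) {w : ℝ}
    (hw : w = 0 ∨ w = 2) : (R p)^[m] w = 0 ∨ (R p)^[m] w = 2 := by
  rcases hw with rfl | rfl
  · exact .inl (Function.iterate_fixed (R_zero p) m)
  · exact .inr (Function.iterate_fixed (R_two hp0 hp1) m)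

/-- Every value in `(0, 2)` has three distinct preimages under `R` in `(0, 2)`. -/
lemma exists_three_preimages {p w : ℝ} (hp0 : 0 < p) (hp1 : p < 1) (hw0 : 0 < w) (hw2 : w < 2) :
    ∃ g : Fin 3 → ℝ, Function.Injective g ∧ ∀ i, 0 < g i ∧ g i < 2 ∧ R p (g i) = w := by
  wlog hp : p ≤ 1 - p generalizing p
  · simpa only [R_symm] using
      this (p := 1 - p) (by linarith) (by linarith) (by linarith)
  have hc : Continuous (R p) := by unfold R; fun_prop
  obtain ⟨x, ⟨hx0, hx1⟩, hx⟩ := intermediate_value_Ioo hp0.le hc.continuousOn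
    (show w ∈ Set.Ioo (R p 0) (R p p) by rw [R_zero, R_self hp0 hp1]; exact ⟨hw0, hw2⟩)
  obtain ⟨y, ⟨hy0, hy1⟩, hy⟩ := intermediate_value_Ioo' (show 1 - p ≤ 1 + p by linarith)
    hc.continuousOn (show w ∈ Set.Ioo (R p (1 + p)) (R p (1 - p)) by
      rw [R_one_add_self, R_one_sub_self hp0 hp1]; exact ⟨hw0, hw2⟩)
  obtain ⟨t, ⟨ht0, ht1⟩, ht⟩ := intermediate_value_Ioo (show 2 - p ≤ 2 by linarith)
    hc.continuousOn (show w ∈ Set.Ioo (R p (2 - p)) (R p 2) by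
      rw [R_two_sub_self, R_two hp0 hp1]; exact ⟨hw0, hw2⟩)
  refine ⟨![x, y, t], ?_, ?_⟩
  · intro i j hij
    fin_cases i <;> fin_cases j <;> simp at hij ⊢ <;> linarith
  · intro i
    fin_cases i
    · exact ⟨hx0, by simp; linarith, hx⟩
    · exact ⟨by simp; linarith, by simp; linarith, hy⟩
    · exact ⟨by simp; linarith, ht1, ht⟩

lemma exists_finset_iterate_R {p : ℝ} (hp0 : 0 < p) (hp1 : p < 1) (n : ℕ) :
    ∃ C : Finset ℝ, C.card + 1 = 3 ^ n ∧ ∀ z ∈ C, 0 < z ∧ z < 2 ∧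
      ∃ m < n, (R p)^[m] z = p ∨ (R p)^[m] z = 2 - p := by
  classical
  induction n with
  | zero => exact ⟨∅, by simp, by simp⟩
  | succ n ih =>
    obtain ⟨C, hcard, hC⟩ := ih
    have key : ∀ w : ℝ, ∃ g : Fin 3 → ℝ, w ∈ C →
        Function.Injective g ∧ ∀ i, 0 < g i ∧ g i < 2 ∧ R p (g i) = w := by
      intro w
      by_cases hw : w ∈ C
      · obtain ⟨g, hg⟩ := exists_three_preimages hp0 hp1 (hC w hw).1 (hC w hw).2.1
        exact ⟨g, fun _ => hg⟩
      · exact ⟨0, fun h => absurd h hw⟩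
    choose g hg using key
    have hinj : Set.InjOn (fun x : ℝ × Fin 3 => g x.1 x.2)
        (C ×ˢ (Finset.univ : Finset (Fin 3)) : Finset (ℝ × Fin 3)) := by
      rintro ⟨w, i⟩ hw ⟨v, j⟩ hv h
      have hw : w ∈ C := by simpa using hw
      have hv : v ∈ C := by simpa using hv
      have hwv : w = v := by
        rw [← ((hg w hw).2 i).2.2, ← ((hg v hv).2 j).2.2]
        exact congrArg (R p) h
      subst hwv
      exact congrArg (Prod.mk w) ((hg w hw).1 h)
    have hne : p ≠ 2 - p := by intro h; linarith
    refine ⟨{p, 2 - p} ∪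
      (C ×ˢ (Finset.univ : Finset (Fin 3))).image (fun x => g x.1 x.2), ?_, ?_⟩
    · rw [Finset.card_union_of_disjoint, Finset.card_image_of_injOn hinj, Finset.card_product,
        Finset.card_pair hne, Finset.card_univ, Fintype.card_fin, pow_succ]
      · omega
      · rw [Finset.disjoint_right]
        intro z hz hz'
        obtain ⟨⟨w, i⟩, hwi, rfl⟩ := Finset.mem_image.1 hz
        have hw : w ∈ C := by simpa using hwi
        obtain ⟨h0, h2, -⟩ := hC w hw
        have hR := ((hg w hw).2 i).2.2
        rcases Finset.mem_insert.1 hz' with h | h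
        · dsimp only at h
          rw [h, R_self hp0 hp1] at hR
          linarith
        · rw [Finset.mem_singleton] at h
          dsimp only at h
          rw [h, R_two_sub_self] at hR
          linarith
    · intro z hz
      simp only [Finset.mem_union, Finset.mem_insert, Finset.mem_singleton,
        Finset.mem_image] at hz
      rcases hz with (rfl | rfl) | ⟨⟨w, i⟩, hwi, rfl⟩
      · exact ⟨hp0, by linarith, 0, by simp, .inl rfl⟩
      · exact ⟨by linarith, by linarith, 0, by simp, .inr rfl⟩
      · have hw : w ∈ C := by simpa using hwi
        obtain ⟨-, -, m, hm, h⟩ := hC w hw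
        obtain ⟨h0, h2, hR⟩ := (hg w hw).2 i
        refine ⟨h0, h2, m + 1, by omega, ?_⟩
        rw [Function.iterate_succ_apply, hR]
        exact h

/-! ### Eigenfunctions -/

lemma one_sub_a_ne_zero {p : ℝ} (hp0 : 0 < p) (hp1 : p < 1) {n k : ℕ} (hk0 : 0 < k)
    (hk : k < 3 ^ n) : 1 - a p n k ≠ 0 := by
  induction n generalizing k with
  | zero => simp at hk; omega
  | succ n ih =>
    rw [pow_succ] at hk
    rw [a]
    split_ifs
    · linarith
    · linarith
    · exact ih (by omega) (by omega)

lemma lap_sub_smul (p : ℝ) (n : ℕ) (c : ℝ) (f g : ℕ → ℝ) (k : ℕ) :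
    lap p n (fun j => g j - c * f j) k = lap p n g k - c * lap p n f k := by
  unfold lap
  split_ifs <;> ring

/-- A solution of the eigenvalue equation vanishing at `0` vanishes identically. -/
lemma eq_zero_of_lap_eq {p : ℝ} (hp0 : 0 < p) (hp1 : p < 1) {n : ℕ} {z : ℝ} {f : ℕ → ℝ}
    (hf : ∀ k ≤ 3 ^ n, lap p n f k = z * f k) (h0 : f 0 = 0) : ∀ k ≤ 3 ^ n, f k = 0 := by
  intro k
  induction k using Nat.strong_induction_on with
  | _ k ih =>
    intro hk
    match k with
    | 0 => exact h0
    | 1 =>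
      have := hf 0 (by omega)
      simp only [lap, if_true, h0] at this
      linarith
    | k + 2 =>
      have h := hf (k + 1) (by omega)
      rw [lap, if_neg (by omega), if_neg (by omega), ih (k + 1) (by omega) (by omega),
        Nat.add_sub_cancel, ih k (by omega) (by omega)] at h
      have ha := one_sub_a_ne_zero hp0 hp1 (n := n) (k := k + 1) (by omega) (by omega)
      have : (1 - a p n (k + 1)) * f (k + 1 + 1) = 0 := by linarith
      exact (mul_eq_zero.1 this).resolve_left ha

lemma IsEigen.exists_eq_mul {p : ℝ} (hp0 : 0 < p) (hp1 : p < 1) {n : ℕ} {z : ℝ} {f g : ℕ → ℝ}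
    (hf : IsEigen p n z f) (hg : IsEigen p n z g) : ∃ c : ℝ, ∀ k ≤ 3 ^ n, g k = c * f k := by
  have hf0 : f 0 ≠ 0 := by
    intro h
    obtain ⟨k, hk, hne⟩ := hf.1
    exact hne (eq_zero_of_lap_eq hp0 hp1 hf.2 h k hk)
  refine ⟨g 0 / f 0, fun k hk => sub_eq_zero.1 ?_⟩
  refine eq_zero_of_lap_eq hp0 hp1 (n := n) (z := z)
    (f := fun j => g j - g 0 / f 0 * f j) (fun j hj => ?_) ?_ k hk
  · rw [lap_sub_smul, hf.2 j hj, hg.2 j hj]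
    ring
  · field_simp
    ring

/-- `Δ_n` as an endomorphism of the space of functions on `{0, …, 3 ^ n}`. -/
def lapEnd (p : ℝ) (n : ℕ) : Module.End ℝ (Fin (3 ^ n + 1) → ℝ) where
  toFun g k := lap p n (fun j => g (Fin.ofNat (3 ^ n + 1) j)) k
  map_add' f g := by
    funext k
    simp only [lap, Pi.add_apply]
    split_ifs <;> ring
  map_smul' c f := by
    funext k
    simp only [lap, Pi.smul_apply, smul_eq_mul, RingHom.id_apply]
    split_ifs <;> ring

lemma lap_congr {p : ℝ} {n : ℕ} {f g : ℕ → ℝ} (h : ∀ k ≤ 3 ^ n, f k = g k) {k : ℕ}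
    (hk : k ≤ 3 ^ n) : lap p n f k = lap p n g k := by
  have hpos : 0 < 3 ^ n := by positivity
  unfold lap
  split_ifs with h0 hN
  · rw [h 0 (by omega), h 1 (by omega)]
  · rw [h _ le_rfl, h _ (by omega)]
  · rw [h k hk, h (k - 1) (by omega), h (k + 1) (by omega)]

lemma hasEigenvalue_lapEnd {p : ℝ} {n : ℕ} {z : ℝ} (hz : z ∈ spec p n) :
    (lapEnd p n).HasEigenvalue z := by
  obtain ⟨f, ⟨k, hk, hne⟩, hf⟩ := hz
  refine Module.End.hasEigenvalue_of_hasEigenvector (x := fun i => f i)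
    ⟨Module.End.mem_eigenspace_iff.2 ?_, ?_⟩
  · funext i
    have hi : (i : ℕ) ≤ 3 ^ n := by omega
    simp only [lapEnd, LinearMap.coe_mk, AddHom.coe_mk, Pi.smul_apply, smul_eq_mul]
    rw [← hf i hi]
    refine lap_congr (fun j hj => ?_) hi
    simp [Fin.ofNat, Nat.mod_eq_of_lt (Nat.lt_succ_of_le hj)]
  · intro h
    exact hne (congrFun h ⟨k, by omega⟩)

lemma spec_finite_and_ncard_le (p : ℝ) (n : ℕ) :
    (spec p n).Finite ∧ (spec p n).ncard ≤ 3 ^ n + 1 := by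
  have hsub : spec p n ⊆ ((lapEnd p n).charpoly.roots.toFinset : Set ℝ) := by
    intro z hz
    have := (Module.End.hasEigenvalue_iff_isRoot_charpoly _ _).1 (hasEigenvalue_lapEnd hz)
    simpa [(lapEnd p n).charpoly_monic.ne_zero] using this
  refine ⟨(Finset.finite_toSet _).subset hsub, ?_⟩
  calc (spec p n).ncard ≤ _ := Set.ncard_le_ncard hsub (Finset.finite_toSet _)
    _ = _ := Set.ncard_coe_finset _
    _ ≤ _ := Multiset.toFinset_card_le _
    _ ≤ _ := Polynomial.card_roots' _
    _ = 3 ^ n + 1 := by rw [LinearMap.charpoly_natDegree]; simp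

lemma isEigen_one (p : ℝ) (n : ℕ) : IsEigen p n 0 (fun _ => 1) := by
  refine ⟨⟨0, by simp, by simp⟩, fun k _ => ?_⟩
  unfold lap
  split_ifs <;> ring

lemma isEigen_neg_one_pow (p : ℝ) (n : ℕ) : IsEigen p n 2 (fun k => (-1) ^ k) := by
  refine ⟨⟨0, by simp, by simp⟩, fun k _ => ?_⟩
  unfold lap
  split_ifs with h0 hN
  · subst h0; norm_num
  · subst hN
    obtain ⟨m, hm⟩ : ∃ m, 3 ^ n = m + 1 := Nat.exists_eq_succ_of_ne_zero (by positivity)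
    rw [hm, Nat.add_sub_cancel]
    ring
  · obtain ⟨m, rfl⟩ := Nat.exists_eq_succ_of_ne_zero h0
    simp only [Nat.succ_eq_add_one, Nat.add_sub_cancel]
    ring

/-- Spectral decimation: interpolation of a function on the coarse grid to the fine grid. -/
def refineFun (A B : ℝ) (g : ℕ → ℝ) (j : ℕ) : ℝ :=
  if j % 3 = 1 then A * g (j / 3) + B * g (j / 3 + 1)
  else if j % 3 = 2 then B * g (j / 3) + A * g (j / 3 + 1)
  else g (j / 3)

lemma refineFun_mul (A B : ℝ) (g : ℕ → ℝ) (k : ℕ) : refineFun A B g (3 * k) = g k := by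
  simp [refineFun]

lemma refineFun_mul_add_one (A B : ℝ) (g : ℕ → ℝ) (k : ℕ) :
    refineFun A B g (3 * k + 1) = A * g k + B * g (k + 1) := by
  rw [refineFun, if_pos (by omega), show (3 * k + 1) / 3 = k by omega]

lemma refineFun_mul_add_two (A B : ℝ) (g : ℕ → ℝ) (k : ℕ) :
    refineFun A B g (3 * k + 2) = B * g k + A * g (k + 1) := by
  rw [refineFun, if_neg (by omega), if_pos (by omega), show (3 * k + 2) / 3 = k by omega]

lemma IsEigen.refineFun {p : ℝ} {n : ℕ} {z w A B : ℝ} {g : ℕ → ℝ} (hg : IsEigen p n w g)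
    (hvert : 1 - A - B * (1 - w) = z)
    (hleft : ∀ k < 3 ^ n, (1 - z) * (A * g k + B * g (k + 1)) =
      (1 - p) * g k + p * (B * g k + A * g (k + 1)))
    (hright : ∀ k < 3 ^ n, (1 - z) * (B * g k + A * g (k + 1)) =
      p * (A * g k + B * g (k + 1)) + (1 - p) * g (k + 1)) :
    IsEigen p (n + 1) z (refineFun A B g) := by
  obtain ⟨⟨k₀, hk₀, hne⟩, hg⟩ := hg
  have hpow : 3 ^ (n + 1) = 3 * 3 ^ n := by ring
  have hpos : 0 < 3 ^ n := by positivity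
  refine ⟨⟨3 * k₀, by omega, by rwa [refineFun_mul]⟩, fun j hj => ?_⟩
  obtain ⟨k, rfl | rfl | rfl⟩ : ∃ k, j = 3 * k ∨ j = 3 * k + 1 ∨ j = 3 * k + 2 :=
    ⟨j / 3, by omega⟩
  · have h := hg k (by omega)
    rw [refineFun_mul]
    rcases Nat.eq_zero_or_pos k with rfl | hk
    · rw [lap, if_pos rfl] at h
      rw [lap, if_pos (by simp)]
      have h1 := refineFun_mul_add_one A B g 0
      have h0 := refineFun_mul A B g 0
      simp only [mul_zero, zero_add] at h0 h1
      rw [h0, h1]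
      linear_combination g 0 * hvert + B * h
    obtain ⟨l, rfl⟩ : ∃ l, k = l + 1 := ⟨k - 1, by omega⟩
    have hpred : 3 * (l + 1) - 1 = 3 * l + 2 := by omega
    by_cases hN : l + 1 = 3 ^ n
    · rw [lap, if_neg (by omega), if_pos hN, ← hN, Nat.add_sub_cancel] at h
      rw [lap, if_neg (by omega), if_pos (by omega), hpow, ← hN, hpred, refineFun_mul,
        refineFun_mul_add_two]
      linear_combination g (l + 1) * hvert + B * h
    · rw [lap, if_neg (by omega), if_neg hN, Nat.add_sub_cancel] at h
      have ha : a p (n + 1) (3 * (l + 1)) = a p n (l + 1) := by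
        rw [a, if_neg (by omega), if_neg (by omega), Nat.mul_div_cancel_left _ (by norm_num)]
      rw [lap, if_neg (by omega), if_neg (by omega), ha, hpred, refineFun_mul,
        refineFun_mul_add_two, refineFun_mul_add_one]
      linear_combination g (l + 1) * hvert + B * h
  · have ha : a p (n + 1) (3 * k + 1) = 1 - p := by rw [a, if_pos (by omega)]
    rw [lap, if_neg (by omega), if_neg (by omega), ha, Nat.add_sub_cancel, refineFun_mul,
      refineFun_mul_add_one, refineFun_mul_add_two]
    linear_combination hleft k (by omega)
  · have ha : a p (n + 1) (3 * k + 2) = p := by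
      rw [a, if_neg (by omega), if_pos (by omega)]
    rw [lap, if_neg (by omega), if_neg (by omega), ha, show 3 * k + 2 - 1 = 3 * k + 1 by omega,
      show 3 * k + 2 + 1 = 3 * (k + 1) by ring, refineFun_mul, refineFun_mul_add_one,
      refineFun_mul_add_two]
    linear_combination hright k (by omega)

lemma self_mem_spec (p : ℝ) (n : ℕ) : p ∈ spec p (n + 1) :=
  ⟨_, (isEigen_neg_one_pow p n).refineFun (A := 1 - p) (B := 0) (by ring)
    (fun k _ => by ring) (fun k _ => by ring)⟩

lemma two_sub_self_mem_spec (p : ℝ) (n : ℕ) : 2 - p ∈ spec p (n + 1) :=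
  ⟨_, (isEigen_one p n).refineFun (A := p - 1) (B := 0) (by ring)
    (fun k _ => by ring) (fun k _ => by ring)⟩

lemma mem_spec_succ {p : ℝ} (hp0 : 0 < p) (hp1 : p < 1) {n : ℕ} {z : ℝ}
    (hz1 : z ≠ 1 - p) (hz2 : z ≠ 1 + p) (hz : R p z ∈ spec p n) : z ∈ spec p (n + 1) := by
  obtain ⟨g, hg⟩ := hz
  have hq : 1 - p ≠ 0 := by linarith
  have hD : (1 - z) ^ 2 - p ^ 2 ≠ 0 := by
    rw [sq_sub_sq]
    refine mul_ne_zero (fun h => hz2 (by linarith)) (fun h => hz1 (by linarith))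
  have hR : p * (1 - p) * R p z = z * (z ^ 2 - 3 * z + 2 + p * (1 - p)) := by
    unfold R
    field_simp
  refine ⟨_, hg.refineFun (A := (1 - z) * (1 - p) / ((1 - z) ^ 2 - p ^ 2))
    (B := p * (1 - p) / ((1 - z) ^ 2 - p ^ 2)) ?_ (fun k _ => ?_) (fun k _ => ?_)⟩
  · field_simp
    linear_combination hR
  · field_simp
    ring
  · field_simp
    ring

lemma mem_spec_of_iterate {p : ℝ} (hp0 : 0 < p) (hp1 : p < 1) {n : ℕ} {z : ℝ}
    (hz : ∃ m < n, (R p)^[m] z = p ∨ (R p)^[m] z = 2 - p) : z ∈ spec p n := by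
  induction n generalizing z with
  | zero => simp at hz
  | succ n ih =>
    obtain ⟨m, hm, h⟩ := hz
    cases m with
    | zero =>
      rcases h with h | h
      · rw [show z = p from h]
        exact self_mem_spec p n
      · rw [show z = 2 - p from h]
        exact two_sub_self_mem_spec p n
    | succ m =>
      rw [Function.iterate_succ_apply] at h
      have hne : ¬ (R p z = 0 ∨ R p z = 2) := by
        intro hz
        rcases iterate_R_eq_zero_or_two hp0 hp1 m hz with h' | h' <;>
          rcases h with h | h <;> linarith
      refine mem_spec_succ hp0 hp1 ?_ ?_ (ih ⟨m, by omega, h⟩)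
      · rintro rfl
        exact hne (.inr (R_one_sub_self hp0 hp1))
      · rintro rfl
        exact hne (.inl (R_one_add_self p))

lemma spec_eq_and_ncard {p : ℝ} (hp0 : 0 < p) (hp1 : p < 1) (n : ℕ) :
    spec p n = {z | z = 0 ∨ z = 2 ∨ ∃ m < n, (R p)^[m] z = p ∨ (R p)^[m] z = 2 - p} ∧
      (spec p n).ncard = 3 ^ n + 1 := by
  classical
  set S := {z | z = 0 ∨ z = 2 ∨ ∃ m < n, (R p)^[m] z = p ∨ (R p)^[m] z = 2 - p}
  obtain ⟨hfin, hle⟩ := spec_finite_and_ncard_le p n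
  have hsub : S ⊆ spec p n := by
    rintro z (rfl | rfl | hz)
    · exact ⟨_, isEigen_one p n⟩
    · exact ⟨_, isEigen_neg_one_pow p n⟩
    · exact mem_spec_of_iterate hp0 hp1 hz
  have hge : 3 ^ n + 1 ≤ S.ncard := by
    obtain ⟨C, hcard, hC⟩ := exists_finset_iterate_R hp0 hp1 n
    have h2 : (2 : ℝ) ∉ C := fun h => lt_irrefl _ (hC 2 h).2.1
    have h0 : (0 : ℝ) ∉ insert 2 C := by
      rw [Finset.mem_insert]
      rintro (h | h)
      · norm_num at h
      · exact lt_irrefl _ (hC 0 h).1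
    have hCS : ((insert 0 (insert 2 C) : Finset ℝ) : Set ℝ) ⊆ S := by
      intro z hz
      rcases Finset.mem_insert.1 hz with h | h
      · exact .inl h
      rcases Finset.mem_insert.1 h with h | h
      · exact .inr (.inl h)
      · exact .inr (.inr (hC z h).2.2)
    have := Set.ncard_le_ncard hCS (hfin.subset hsub)
    rw [Set.ncard_coe_finset, Finset.card_insert_of_notMem h0,
      Finset.card_insert_of_notMem h2] at this
    omega
  have heq : S = spec p n := Set.eq_of_subset_of_ncard_le hsub (hle.trans hge) hfin
  exact ⟨heq.symm, le_antisymm hle (heq ▸ hge)⟩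

theorem stmt2 (p : ℝ) (hp0 : 0 < p) (hp1 : p < 1) :
    -- exactly 3^n + 1 distinct real eigenvalues, each simple
    (∀ n : ℕ, (spec p n).Finite ∧ (spec p n).ncard = 3 ^ n + 1 ∧
      ∀ z ∈ spec p n, ∀ f g : ℕ → ℝ, IsEigen p n z f → IsEigen p n z g →
        ∃ c : ℝ, ∀ k ≤ 3 ^ n, g k = c * f k) ∧
    -- σ(Δ_0) = {0, 2}
    spec p 0 = {0, 2} ∧
    -- σ(Δ_n) = {0,2} ∪ ⋃_{m<n} R^{-m}{1−q, 1+q}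
    (∀ n : ℕ, 1 ≤ n →
      spec p n = {0, 2} ∪
        ⋃ m ∈ Finset.range n,
          {z : ℝ | (R p)^[m] z = 1 - (1 - p) ∨ (R p)^[m] z = 1 + (1 - p)}) ∧
    -- memberships
    (∀ n : ℕ, 1 ≤ n →
      (0 : ℝ) ∈ spec p n ∧ (1 - (1 - p)) ∈ spec p n ∧
      (1 + (1 - p)) ∈ spec p n ∧ (2 : ℝ) ∈ spec p n) ∧
    -- 1 ± p are eigenvalues iff p = 1/2
    (∀ n : ℕ, 1 ≤ n → (((1 - p) ∈ spec p n ∧ (1 + p) ∈ spec p n) ↔ p = 1 / 2)) := by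
  have hq1 : 1 - (1 - p) = p := by ring
  have hq2 : 1 + (1 - p) = 2 - p := by ring
  simp only [hq1, hq2]
  have hspec := fun n => (spec_eq_and_ncard hp0 hp1 n).1
  refine ⟨fun n => ⟨(spec_finite_and_ncard_le p n).1, (spec_eq_and_ncard hp0 hp1 n).2,
    fun z _ f g hf hg => hf.exists_eq_mul hp0 hp1 hg⟩, ?_, fun n _ => ?_, fun n hn => ?_,
    fun n hn => ?_⟩
  · rw [hspec]
    ext z
    simp
  · rw [hspec]
    ext z
    simp [or_assoc]
  · obtain ⟨n, rfl⟩ : ∃ m, n = m + 1 := ⟨n - 1, by omega⟩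
    exact ⟨⟨_, isEigen_one p _⟩, self_mem_spec p n, two_sub_self_mem_spec p n,
      ⟨_, isEigen_neg_one_pow p _⟩⟩
  · constructor
    · rintro ⟨h, -⟩
      rw [hspec] at h
      rcases h with h | h | ⟨m, -, h⟩
      · linarith
      · linarith
      · cases m with
        | zero => rcases h with h | h <;> linarith [show 1 - p = _ from h]
        | succ m =>
          rw [Function.iterate_succ_apply, R_one_sub_self hp0 hp1,
            Function.iterate_fixed (R_two hp0 hp1) m] at h
          rcases h with h | h <;> linarith
    · intro hp
      obtain ⟨n, rfl⟩ : ∃ m, n = m + 1 := ⟨n - 1, by omega⟩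
      have h1 := self_mem_spec p n
      have h2 := two_sub_self_mem_spec p n
      rw [show 1 - p = p by linarith, show 1 + p = 2 - p by linarith]
      exact ⟨h1, h2⟩
end
end

section
/- Assume 0 < p < 1/2. With f_{n_0+i} the lowest-branch spectral-decimation extensions of a Δ_{n_0}-eigenfunction f_{n_0}, the quantity sup_{i ≥ 0} max_{0 ≤ k ≤ 3^{n_0+i}} |f_{n_0+i}(k)| is finite. -/
noncomputable section

/-- The spectral-decimation extension with parameter `z`. -/
def sdExt (p z : ℝ) (f : ℕ → ℝ) (m : ℕ) : ℝ :=
  if m % 3 = 0 then f (m / 3)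
  else if m % 3 = 1 then
    ((1 - p) * (1 - z) * f (m / 3) + p * (1 - p) * f (m / 3 + 1)) /
      ((1 - p - z) * (1 + p - z))
  else
    ((1 - p) * (1 - z) * f (m / 3 + 1) + p * (1 - p) * f (m / 3)) /
      ((1 - p - z) * (1 + p - z))

/-- The cubic `R` expands by a factor of at least `2` on `[0, p]`. -/
theorem two_mul_le_R {p z : ℝ} (hp0 : 0 < p) (hp : p < 1 / 2) (hz0 : 0 ≤ z) (hzp : z ≤ p) :
    2 * z ≤ R p z := by
  have hpq : 0 < p * (1 - p) := mul_pos hp0 (by linarith)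
  rw [R, le_div_iff₀ hpq]
  have h : 2 * (p * (1 - p)) ≤ z ^ 2 - 3 * z + 2 + p * (1 - p) := by nlinarith
  nlinarith [mul_le_mul_of_nonneg_left h hz0]

/-- The weights in the spectral-decimation extension add up to `q / (q - z)`, which is at most
`exp (z / (1 - 2 * p))`. -/
theorem abs_weighted_div_le {p z x y C : ℝ} (hp0 : 0 < p) (hp : p < 1 / 2) (hz0 : 0 ≤ z)
    (hzp : z ≤ p) (hx : |x| ≤ C) (hy : |y| ≤ C) :
    |((1 - p) * (1 - z) * x + p * (1 - p) * y) / ((1 - p - z) * (1 + p - z))| ≤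
      C * Real.exp (z / (1 - 2 * p)) := by
  have hC : 0 ≤ C := (abs_nonneg x).trans hx
  have h1 : 0 < 1 - p - z := by linarith
  have h2 : 0 < 1 + p - z := by linarith
  have h3 : 0 < 1 - 2 * p := by linarith
  have hw1 : 0 ≤ (1 - p) * (1 - z) := mul_nonneg (by linarith) (by linarith)
  have hw2 : 0 ≤ p * (1 - p) := mul_nonneg hp0.le (by linarith)
  have hexp : (1 - p) / (1 - p - z) ≤ Real.exp (z / (1 - 2 * p)) := calc
    (1 - p) / (1 - p - z) = z / (1 - p - z) + 1 := by field_simp; ring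
    _ ≤ z / (1 - 2 * p) + 1 := by
      linarith [div_le_div_of_nonneg_left hz0 h3 (show 1 - 2 * p ≤ 1 - p - z by linarith)]
    _ ≤ _ := Real.add_one_le_exp _
  have hnum : |(1 - p) * (1 - z) * x + p * (1 - p) * y| ≤
      (1 - p) * (1 - z) * C + p * (1 - p) * C := by
    refine (abs_add_le _ _).trans ?_
    rw [abs_mul, abs_mul (p * (1 - p)), abs_of_nonneg hw1, abs_of_nonneg hw2]
    gcongr
  rw [abs_div, abs_of_pos (mul_pos h1 h2)]
  calc _ ≤ ((1 - p) * (1 - z) * C + p * (1 - p) * C) / ((1 - p - z) * (1 + p - z)) := by gcongr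
    _ = C * ((1 - p) / (1 - p - z)) := by field_simp; ring
    _ ≤ _ := by gcongr

theorem abs_sdExt_le {p z C : ℝ} {f : ℕ → ℝ} {N : ℕ} (hp0 : 0 < p) (hp : p < 1 / 2)
    (hz0 : 0 ≤ z) (hzp : z ≤ p) (hf : ∀ k ≤ N, |f k| ≤ C) {m : ℕ} (hm : m ≤ 3 * N) :
    |sdExt p z f m| ≤ C * Real.exp (z / (1 - 2 * p)) := by
  unfold sdExt
  split_ifs with h0 h1
  · have hC : 0 ≤ C := (abs_nonneg _).trans (hf 0 N.zero_le)
    exact (hf _ (by omega)).trans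
      (le_mul_of_one_le_right hC (Real.one_le_exp (div_nonneg hz0 (by linarith))))
  · exact abs_weighted_div_le hp0 hp hz0 hzp (hf _ (by omega)) (hf _ (by omega))
  · exact abs_weighted_div_le hp0 hp hz0 hzp (hf _ (by omega)) (hf _ (by omega))

/-- Uniform boundedness of the lowest-branch spectral-decimation extensions of an
eigenfunction of `Δ_{n₀}`: here `fs i` is the extension at level `n₀ + i`, and
`lam i` the corresponding eigenvalue, with `lam (i+1) = φ(lam i)` the lowest branch
of `R⁻¹`. -/
theorem stmt6 (p : ℝ) (hp0 : 0 < p) (hp : p < 1 / 2)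
    (φ : ℝ → ℝ)
    (hφmem : ∀ z ∈ Set.Icc (0 : ℝ) 2, φ z ∈ Set.Icc 0 (min p (1 - p)))
    (hφinv : ∀ z ∈ Set.Icc (0 : ℝ) 2, R p (φ z) = z)
    (n₀ : ℕ) (lam : ℕ → ℝ) (fs : ℕ → ℕ → ℝ)
    (hlam0 : lam 0 ∈ Set.Icc (0 : ℝ) 2)
    (hlam : ∀ i, lam (i + 1) = φ (lam i))
    (hne : ∃ k ≤ 3 ^ n₀, fs 0 k ≠ 0)
    (heig : ∀ k ≤ 3 ^ n₀, lap p n₀ (fs 0) k = lam 0 * fs 0 k)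
    (hfs : ∀ i, fs (i + 1) = sdExt p (lam (i + 1)) (fs i)) :
    ∃ M : ℝ, ∀ i : ℕ, ∀ k ≤ 3 ^ (n₀ + i), |fs i k| ≤ M := by
  have hφ : ∀ z ∈ Set.Icc (0 : ℝ) 2, 0 ≤ φ z ∧ φ z ≤ p ∧ 2 * φ z ≤ z := fun z hz ↦ by
    obtain ⟨h0, h1⟩ := hφmem z hz
    have h2 := h1.trans (min_le_left _ _)
    exact ⟨h0, h2, (two_mul_le_R hp0 hp h0 h2).trans_eq (hφinv z hz)⟩
  have hmem : ∀ i, lam i ∈ Set.Icc (0 : ℝ) 2 := fun i ↦ by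
    induction i with
    | zero => exact hlam0
    | succ i ih =>
      obtain ⟨h0, h1, -⟩ := hφ _ ih
      rw [hlam]
      exact ⟨h0, by linarith⟩
  have hc : 0 < 1 - 2 * p := by linarith
  obtain ⟨C, hC⟩ : ∃ C, ∀ k ≤ 3 ^ n₀, |fs 0 k| ≤ C := by
    obtain ⟨C, hC⟩ := ((Set.finite_Iic (3 ^ n₀)).image fun k ↦ |fs 0 k|).bddAbove
    exact ⟨C, fun k hk ↦ hC ⟨k, hk, rfl⟩⟩
  have hC0 : 0 ≤ C := (abs_nonneg _).trans (hC 0 (Nat.zero_le _))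
  -- Since `2 * lam (i + 1) ≤ lam i`, the growth factors `exp (lam (i + 1) / (1 - 2 * p))` telescope.
  have key : ∀ i, ∀ k ≤ 3 ^ (n₀ + i),
      |fs i k| ≤ C * Real.exp ((lam 0 - lam i) / (1 - 2 * p)) := fun i ↦ by
    induction i with
    | zero => simpa using hC
    | succ i ih =>
      intro k hk
      obtain ⟨h0, h1, h2⟩ := hφ _ (hmem i)
      rw [← hlam] at h0 h1 h2
      rw [hfs]
      refine (abs_sdExt_le hp0 hp h0 h1 ih (by rw [← add_assoc, pow_succ] at hk; omega)).trans ?_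
      rw [mul_assoc, ← Real.exp_add, ← add_div]
      gcongr
      linarith
  refine ⟨C * Real.exp (lam 0 / (1 - 2 * p)), fun i k hk ↦ (key i k hk).trans ?_⟩
  gcongr
  linarith [(hmem i).1]
end
end

section
/- Let 0 < p < 1/2, q = 1 − p, and let z be a real number with 0 < z < p. Then for all real numbers A, B: | (q(1−z)A + pq·B)/((q−z)(1+p−z)) − (A + pB)/(1+p) | ≤ max(|A|, |B|) · z/(q−z). -/
/-- Comparison of the spectral-decimation extension value
`F(A,B,z) = (q(1−z)A + pqB)/((q−z)(1+p−z))` with the harmonic extension value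
`F(A,B,0) = (A + pB)/(1+p)`, where `q = 1 − p`:
`|F(A,B,z) − F(A,B,0)| ≤ max(|A|,|B|)·z/(q−z)` for `0 < z < p < 1/2`. -/
theorem stmt7 (p : ℝ) (hp0 : 0 < p) (hp : p < 1 / 2) (z : ℝ)
    (hz0 : 0 < z) (hzp : z < p) (A B : ℝ) :
    |((1 - p) * (1 - z) * A + p * (1 - p) * B) / (((1 - p) - z) * ((1 + p) - z)) -
        (A + p * B) / (1 + p)| ≤
      max |A| |B| * (z / ((1 - p) - z)) := by
  have hq : 0 < (1 - p) - z := by linarith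
  have hr : 0 < (1 + p) - z := by linarith
  have h1 : 0 < 1 + p := by linarith
  set D := ((1 - p) - z) * ((1 + p) - z) * (1 + p) with hD
  have hDpos : 0 < D := by positivity
  set a := z * (1 + p ^ 2 - z) / D with ha
  set b := p * z * (2 - z) / D with hb
  have ha0 : 0 ≤ a :=
    div_nonneg (mul_nonneg hz0.le (by nlinarith [sq_nonneg p])) hDpos.le
  have hb0 : 0 ≤ b :=
    div_nonneg (mul_nonneg (by positivity) (by linarith)) hDpos.le
  have hdiff : ((1 - p) * (1 - z) * A + p * (1 - p) * B) / (((1 - p) - z) * ((1 + p) - z)) -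
      (A + p * B) / (1 + p) = a * A + b * B := by
    rw [ha, hb, hD]
    field_simp
    ring
  have hsum : a + b = z / ((1 - p) - z) := by
    rw [ha, hb, hD]
    field_simp
    ring
  rw [hdiff, ← hsum]
  calc |a * A + b * B| ≤ |a * A| + |b * B| := abs_add_le _ _
    _ = a * |A| + b * |B| := by rw [abs_mul, abs_mul, abs_of_nonneg ha0, abs_of_nonneg hb0]
    _ ≤ a * max |A| |B| + b * max |A| |B| := by
      gcongr
      · exact le_max_left _ _
      · exact le_max_right _ _
    _ = max |A| |B| * (a + b) := by ring
end

section
/- Assume 0 < p < 1/2 and let n ≥ 0. If λ_{n,0} < λ_{n,1} < ⋯ < λ_{n,3^n} are the eigenvalues of Δ_n listed in increasing order, and λ_{n+1,0} < λ_{n+1,1} < ⋯ < λ_{n+1,3^{n+1}} are the eigenvalues of Δ_{n+1} listed in increasing order, then λ_{n+1,k} = φ(λ_{n,k}) for every 0 ≤ k ≤ 3^n. -/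
noncomputable section

lemma a_mem_Icc {p : ℝ} (hp0 : 0 ≤ p) (hp1 : p ≤ 1) (n k : ℕ) : a p n k ∈ Set.Icc (0 : ℝ) 1 := by
  induction n generalizing k with
  | zero => simp [a]
  | succ n ih =>
    unfold a
    split_ifs
    · constructor <;> linarith
    · exact ⟨hp0, hp1⟩
    · exact ih _

/-- The spectrum lies in `[0, 2]`, because `1 - Δ_n` is a Markov operator. -/
lemma spec_subset_Icc {p : ℝ} (hp0 : 0 ≤ p) (hp1 : p ≤ 1) (n : ℕ) :
    spec p n ⊆ Set.Icc (0 : ℝ) 2 := by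
  rintro z ⟨f, ⟨k₀, hk₀, hf₀⟩, hf⟩
  obtain ⟨m, hm, hmax⟩ := Finset.exists_max_image (Finset.range (3 ^ n + 1)) (fun k => |f k|)
    ⟨0, by simp⟩
  have hm' : m ≤ 3 ^ n := by simpa [Nat.lt_succ_iff] using hm
  have hmax' : ∀ k ≤ 3 ^ n, |f k| ≤ |f m| := fun k hk =>
    hmax k (by simpa [Nat.lt_succ_iff] using hk)
  have hpos : 0 < |f m| := (abs_pos.mpr hf₀).trans_le (hmax' k₀ hk₀)
  have h3 : 1 ≤ 3 ^ n := Nat.one_le_pow _ _ (by norm_num)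
  have key : |(1 - z) * f m| ≤ |f m| := by
    have h := hf m hm'
    unfold lap at h
    split_ifs at h with h0 h1
    · subst h0
      rw [show (1 - z) * f 0 = f 1 by linarith]
      exact hmax' 1 h3
    · rw [← h1] at h
      rw [show (1 - z) * f m = f (m - 1) by linarith]
      exact hmax' _ (by omega)
    · obtain ⟨ha0, ha1⟩ := a_mem_Icc hp0 hp1 n m
      rw [show (1 - z) * f m = a p n m * f (m - 1) + (1 - a p n m) * f (m + 1) by linarith]
      refine (abs_add_le _ _).trans ?_
      rw [abs_mul, abs_mul, abs_of_nonneg ha0, abs_of_nonneg (sub_nonneg.mpr ha1)]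
      nlinarith [mul_le_mul_of_nonneg_left (hmax' (m - 1) (by omega)) ha0,
        mul_le_mul_of_nonneg_left (hmax' (m + 1) (by omega)) (sub_nonneg.mpr ha1)]
  rw [abs_mul] at key
  have hz : |1 - z| ≤ 1 := by
    by_contra! h
    nlinarith
  rw [abs_le] at hz
  constructor <;> linarith [hz.1, hz.2]

lemma lap_zero (p : ℝ) (n : ℕ) (f : ℕ → ℝ) : lap p n f 0 = f 0 - f 1 := by
  simp [lap]

lemma lap_last (p : ℝ) (n : ℕ) (f : ℕ → ℝ) :
    lap p n f (3 ^ n) = f (3 ^ n) - f (3 ^ n - 1) := by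
  simp [lap]

lemma lap_interior (p : ℝ) {n k : ℕ} (f : ℕ → ℝ) (hk : k + 1 < 3 ^ n) :
    lap p n f (k + 1) =
      f (k + 1) - a p n (k + 1) * f k - (1 - a p n (k + 1)) * f (k + 2) := by
  unfold lap
  rw [if_neg (by omega), if_neg (by omega)]
  rfl

lemma lap_succ_three_mul_add_one (p : ℝ) {n j : ℕ} (f : ℕ → ℝ) (hj : j < 3 ^ n) :
    lap p (n + 1) f (3 * j + 1) =
      f (3 * j + 1) - (1 - p) * f (3 * j) - p * f (3 * j + 2) := by
  rw [lap_interior p f (by rw [pow_succ]; omega)]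
  have ha : a p (n + 1) (3 * j + 1) = 1 - p := by
    unfold a
    rw [if_pos (by omega)]
  rw [ha]
  ring

lemma lap_succ_three_mul_add_two (p : ℝ) {n j : ℕ} (f : ℕ → ℝ) (hj : j < 3 ^ n) :
    lap p (n + 1) f (3 * j + 2) =
      f (3 * j + 2) - p * f (3 * j + 1) - (1 - p) * f (3 * j + 3) := by
  rw [lap_interior p f (by rw [pow_succ]; omega)]
  have ha : a p (n + 1) (3 * j + 1 + 1) = p := by
    unfold a
    rw [if_neg (by omega), if_pos (by omega)]
  rw [ha]

lemma lap_succ_three_mul_add_three (p : ℝ) {n j : ℕ} (f : ℕ → ℝ) (hj : j + 1 < 3 ^ n) :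
    lap p (n + 1) f (3 * j + 3) =
      f (3 * j + 3) - a p n (j + 1) * f (3 * j + 2) - (1 - a p n (j + 1)) * f (3 * j + 4) := by
  rw [lap_interior p f (by rw [pow_succ]; omega)]
  have ha : a p (n + 1) (3 * j + 2 + 1) = a p n (j + 1) := by
    rw [a, if_neg (by omega), if_neg (by omega)]
    congr 1
    omega
  rw [ha]

/-- Decimation: if the equations `Δ_{n+1} f = z f`, solved at the interior points of each cell,
hold, then at the cell endpoints the defects of `f` for `(Δ_{n+1}, z)` and of its restriction
for `(Δ_n, R(z))` are proportional. -/
lemma lap_succ_sub_mul_eq {p z : ℝ} (hp0 : p ≠ 0) (hp1 : 1 - p ≠ 0) {n : ℕ} {f : ℕ → ℝ}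
    (h1 : ∀ j < 3 ^ n, ((1 - z) ^ 2 - p ^ 2) * f (3 * j + 1) =
      (1 - p) * ((1 - z) * f (3 * j) + p * f (3 * j + 3)))
    (h2 : ∀ j < 3 ^ n, ((1 - z) ^ 2 - p ^ 2) * f (3 * j + 2) =
      (1 - p) * (p * f (3 * j) + (1 - z) * f (3 * j + 3))) {k : ℕ} (hk : k ≤ 3 ^ n) :
    ((1 - z) ^ 2 - p ^ 2) * (lap p (n + 1) f (3 * k) - z * f (3 * k)) =
      p * (1 - p) * (lap p n (fun j => f (3 * j)) k - R p z * f (3 * k)) := by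
  have h3 : 1 ≤ 3 ^ n := Nat.one_le_pow _ _ (by norm_num)
  have hR : p * (1 - p) * R p z = z * (z ^ 2 - 3 * z + 2 + p * (1 - p)) := by
    unfold R
    field_simp
  rcases Nat.eq_zero_or_pos k with rfl | hk0
  · have e1 := h1 0 (by omega)
    simp only [mul_zero, zero_add, lap_zero, mul_one] at e1 ⊢
    linear_combination -e1 + f 0 * hR
  obtain ⟨m, rfl⟩ : ∃ m, k = m + 1 := ⟨k - 1, by omega⟩
  have e2 := h2 m (by omega)
  rcases hk.eq_or_lt with hk | hk
  · have e : 3 * m + 3 = 3 ^ (n + 1) := by rw [pow_succ]; omega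
    have l1 := lap_last p (n + 1) f
    rw [← e] at l1
    have l2 := lap_last p n (fun j => f (3 * j))
    rw [← hk] at l2
    simp only [Nat.add_sub_cancel, mul_add, mul_one,
      show 3 * m + 3 - 1 = 3 * m + 2 by omega] at l1 l2 ⊢
    rw [l1, l2]
    linear_combination -e2 + f (3 * m + 3) * hR
  · have e1 := h1 (m + 1) hk
    have l1 := lap_succ_three_mul_add_three p f hk
    have l2 := lap_interior p (fun j => f (3 * j)) hk
    simp only [mul_add, mul_one, add_assoc, Nat.reduceAdd, Nat.reduceMul] at e1 l1 l2 ⊢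
    rw [l1, l2]
    linear_combination -a p n (m + 1) * e2 - (1 - a p n (m + 1)) * e1 + f (3 * m + 3) * hR

lemma R_mem_spec {p z : ℝ} (hp0 : p ≠ 0) (hp1 : 1 - p ≠ 0) (hD : (1 - z) ^ 2 - p ^ 2 ≠ 0)
    {n : ℕ} (hz : z ∈ spec p (n + 1)) : R p z ∈ spec p n := by
  obtain ⟨f, ⟨k₀, hk₀, hf₀⟩, hf⟩ := hz
  have h1 : ∀ j < 3 ^ n, ((1 - z) ^ 2 - p ^ 2) * f (3 * j + 1) =
      (1 - p) * ((1 - z) * f (3 * j) + p * f (3 * j + 3)) := fun j hj => by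
    have u := hf (3 * j + 1) (by rw [pow_succ]; omega)
    have v := hf (3 * j + 2) (by rw [pow_succ]; omega)
    rw [lap_succ_three_mul_add_one p f hj] at u
    rw [lap_succ_three_mul_add_two p f hj] at v
    linear_combination (1 - z) * u + p * v
  have h2 : ∀ j < 3 ^ n, ((1 - z) ^ 2 - p ^ 2) * f (3 * j + 2) =
      (1 - p) * (p * f (3 * j) + (1 - z) * f (3 * j + 3)) := fun j hj => by
    have u := hf (3 * j + 1) (by rw [pow_succ]; omega)
    have v := hf (3 * j + 2) (by rw [pow_succ]; omega)
    rw [lap_succ_three_mul_add_one p f hj] at u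
    rw [lap_succ_three_mul_add_two p f hj] at v
    linear_combination p * u + (1 - z) * v
  refine ⟨fun j => f (3 * j), ?_, fun k hk => ?_⟩
  · by_contra! h
    have hmul : ∀ j ≤ 3 ^ n, f (3 * j) = 0 := h
    rw [pow_succ] at hk₀
    have hmod := Nat.div_add_mod k₀ 3
    set j := k₀ / 3
    have hlt : k₀ % 3 < 3 := Nat.mod_lt _ (by norm_num)
    rcases Nat.eq_zero_or_pos (k₀ % 3) with h0 | h0
    · exact hf₀ (by rw [← hmod, h0]; exact hmul j (by omega))
    · have hj : j < 3 ^ n := by omega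
      have z0 := hmul j hj.le
      have z3 : f (3 * j + 3) = 0 := hmul (j + 1) hj
      apply hf₀
      apply (mul_eq_zero.mp _).resolve_left hD
      obtain h | h : k₀ % 3 = 1 ∨ k₀ % 3 = 2 := by omega
      · rw [← hmod, h, h1 j hj, z0, z3]
        ring
      · rw [← hmod, h, h2 j hj, z0, z3]
        ring
  · have h := lap_succ_sub_mul_eq hp0 hp1 h1 h2 hk
    rw [hf (3 * k) (by rw [pow_succ]; omega), sub_self, mul_zero, eq_comm] at h
    exact sub_eq_zero.mp ((mul_eq_zero.mp h).resolve_left (mul_ne_zero hp0 hp1))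

lemma mem_spec_of_R_mem_spec {p z : ℝ} (hp0 : p ≠ 0) (hp1 : 1 - p ≠ 0)
    (hD : (1 - z) ^ 2 - p ^ 2 ≠ 0) {n : ℕ} (hz : R p z ∈ spec p n) : z ∈ spec p (n + 1) := by
  obtain ⟨g, ⟨k₀, hk₀, hg₀⟩, hg⟩ := hz
  let f : ℕ → ℝ := fun m =>
    if m % 3 = 0 then g (m / 3)
    else if m % 3 = 1 then
      (1 - p) * ((1 - z) * g (m / 3) + p * g (m / 3 + 1)) / ((1 - z) ^ 2 - p ^ 2)
    else (1 - p) * (p * g (m / 3) + (1 - z) * g (m / 3 + 1)) / ((1 - z) ^ 2 - p ^ 2)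
  have f0 : ∀ j, f (3 * j) = g j := fun j => by simp [f]
  have f3 : ∀ j, f (3 * j + 3) = g (j + 1) := fun j => f0 (j + 1)
  have f1 : ∀ j, f (3 * j + 1) =
      (1 - p) * ((1 - z) * g j + p * g (j + 1)) / ((1 - z) ^ 2 - p ^ 2) := fun j => by
    simp only [f, show (3 * j + 1) % 3 = 1 by omega, show (3 * j + 1) / 3 = j by omega]
    norm_num
  have f2 : ∀ j, f (3 * j + 2) =
      (1 - p) * (p * g j + (1 - z) * g (j + 1)) / ((1 - z) ^ 2 - p ^ 2) := fun j => by
    simp only [f, show (3 * j + 2) % 3 = 2 by omega, show (3 * j + 2) / 3 = j by omega]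
    norm_num
  refine ⟨f, ⟨3 * k₀, by rw [pow_succ]; omega, by rwa [f0]⟩, fun k hk => ?_⟩
  rw [pow_succ] at hk
  obtain ⟨j, h | h | h⟩ : ∃ j, k = 3 * j ∨ k = 3 * j + 1 ∨ k = 3 * j + 2 :=
    ⟨k / 3, by omega⟩
  · subst h
    have hj : j ≤ 3 ^ n := by omega
    have h := lap_succ_sub_mul_eq (n := n) (f := f) hp0 hp1
      (fun i _ => by rw [f0, f1, f3, mul_div_cancel₀ _ hD])
      (fun i _ => by rw [f0, f2, f3, mul_div_cancel₀ _ hD]) hj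
    simp only [f0] at h
    rw [hg j hj, sub_self, mul_zero] at h
    rw [f0]
    exact sub_eq_zero.mp ((mul_eq_zero.mp h).resolve_left hD)
  · subst h
    rw [lap_succ_three_mul_add_one p f (by omega), f0, f1, f2]
    field_simp
    ring
  · subst h
    rw [lap_succ_three_mul_add_two p f (by omega), f1, f2, f3]
    field_simp
    ring

lemma strictMonoOn_R {p : ℝ} (hp0 : 0 < p) (hp : p < 1 / 2) :
    StrictMonoOn (R p) (Set.Icc 0 p) := by
  rintro x ⟨hx0, hxp⟩ y ⟨hy0, hyp⟩ hxy
  have hpq : 0 < p * (1 - p) := mul_pos hp0 (by linarith)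
  unfold R
  rw [div_lt_div_iff_of_pos_right hpq]
  have key : 0 < y ^ 2 + x * y + x ^ 2 - 3 * (x + y) + 2 + p * (1 - p) := by
    nlinarith [mul_nonneg (sub_nonneg.mpr hxp) (sub_nonneg.mpr hyp), mul_pos hp0 hp0]
  nlinarith [mul_pos (sub_pos.mpr hxy) key]

/-- If `ev` (resp. `ev'`) lists the eigenvalues of `Δ_n` (resp. `Δ_{n+1}`) in increasing
order, then `λ_{n+1,k} = φ(λ_{n,k})` for all `0 ≤ k ≤ 3^n`, where `φ` is the lowest branch
of `R⁻¹`. -/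
theorem stmt9 (p : ℝ) (hp0 : 0 < p) (hp : p < 1 / 2)
    (φ : ℝ → ℝ)
    (hφmem : ∀ z ∈ Set.Icc (0 : ℝ) 2, φ z ∈ Set.Icc 0 (min p (1 - p)))
    (hφinv : ∀ z ∈ Set.Icc (0 : ℝ) 2, R p (φ z) = z)
    (n : ℕ) (ev ev' : ℕ → ℝ)
    (hmono : ∀ j k : ℕ, j < k → k ≤ 3 ^ n → ev j < ev k)
    (hmem : ∀ k ≤ 3 ^ n, ev k ∈ spec p n)
    (hsurj : ∀ z ∈ spec p n, ∃ k ≤ 3 ^ n, ev k = z)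
    (hmono' : ∀ j k : ℕ, j < k → k ≤ 3 ^ (n + 1) → ev' j < ev' k)
    (hmem' : ∀ k ≤ 3 ^ (n + 1), ev' k ∈ spec p (n + 1))
    (hsurj' : ∀ z ∈ spec p (n + 1), ∃ k ≤ 3 ^ (n + 1), ev' k = z) :
    ∀ k ≤ 3 ^ n, ev' k = φ (ev k) := by
  have hp1 : 1 - p ≠ 0 := by linarith
  have hD : ∀ z ≤ p, (1 - z) ^ 2 - p ^ 2 ≠ 0 := fun z hz => by nlinarith
  have hev : ∀ k ≤ 3 ^ n, ev k ∈ Set.Icc (0 : ℝ) 2 := fun k hk =>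
    spec_subset_Icc hp0.le (by linarith) n (hmem k hk)
  have hφp : ∀ k ≤ 3 ^ n, φ (ev k) ∈ Set.Icc 0 p := fun k hk =>
    ⟨(hφmem _ (hev k hk)).1, (hφmem _ (hev k hk)).2.trans (min_le_left _ _)⟩
  have hlt : ∀ i k, k ≤ 3 ^ n → i < k → φ (ev i) < φ (ev k) := fun i k hk hik => by
    rw [← (strictMonoOn_R hp0 hp).lt_iff_lt (hφp i (by omega)) (hφp k hk),
      hφinv _ (hev i (by omega)), hφinv _ (hev k hk)]
    exact hmono i k hik hk
  have hle : 3 ^ n ≤ 3 ^ (n + 1) := Nat.pow_le_pow_right (by norm_num) (by omega)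
  intro k
  induction k using Nat.strong_induction_on with
  | _ k ih =>
    intro hk
    obtain ⟨j, hj, hjk⟩ := hsurj' (φ (ev k)) (mem_spec_of_R_mem_spec hp0.ne' hp1
      (hD _ (hφp k hk).2) (by rw [hφinv _ (hev k hk)]; exact hmem k hk))
    rcases lt_trichotomy j k with hlt' | rfl | hgt
    · exact absurd (hjk.symm.trans (ih j hlt' (by omega))) (hlt j k hk hlt').ne'
    · exact hjk
    · have hlt₁ : ev' k < φ (ev k) := hjk ▸ hmono' k j hgt hj
      have hp' : ev' k ≤ p := hlt₁.le.trans (hφp k hk).2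
      have hmemk := hmem' k (hk.trans hle)
      obtain ⟨i, hi, hik⟩ := hsurj _ (R_mem_spec hp0.ne' hp1 (hD _ hp') hmemk)
      have heq : φ (ev i) = ev' k := (strictMonoOn_R hp0 hp).injOn (hφp i hi)
        ⟨(spec_subset_Icc hp0.le (by linarith) _ hmemk).1, hp'⟩
        ((hφinv _ (hev i hi)).trans hik)
      rcases lt_trichotomy i k with h | rfl | h
      · exact absurd ((ih i h hi).trans heq) (hmono' i k h (hk.trans hle)).ne
      · exact heq.symm
      · exact absurd (heq ▸ hlt₁) (hlt k i hi h).not_gt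
end
end

section
/- Let λ_1 < λ_2 < λ_3 be real numbers with λ_i ∉ {1−p, 1+p} for i = 1,2,3, and suppose R(λ_1) = R(λ_2) = R(λ_3) = λ for some real λ. Then for every α ∈ ℝ, the linear system α_1 + α_2 + α_3 = α, Σ_{i=1}^3 q(1−λ_i)·α_i/((1−p−λ_i)(1+p−λ_i)) = 0, Σ_{i=1}^3 pq·α_i/((1−p−λ_i)(1+p−λ_i)) = 0 has a unique solution (α_1, α_2, α_3), which is given by α_3 = (1+p−λ_3)(q−λ_3)·α/(3λ_3^2 − 6λ_3 + 2 + pq), α_1 = ((λ_3−λ_2)(q−λ_1)(1+p−λ_1))/((λ_2−λ_1)(q−λ_3)(1+p−λ_3))·α_3, and α_2 = ((λ_1−λ_3)(q−λ_2)(1+p−λ_2))/((λ_2−λ_1)(q−λ_3)(1+p−λ_3))·α_3. -/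
noncomputable section

/-- If a monic cubic `z³ - 3z² + cz` takes the same value at three distinct points, those points
satisfy Vieta's relations, stated here as the sum and the factored derivative at the last point. -/
lemma vieta_of_cubic_eq {c x y z : ℝ} (hxy : x ≠ y) (hyz : y ≠ z) (hxz : x ≠ z)
    (h1 : x * (x ^ 2 - 3 * x + c) = z * (z ^ 2 - 3 * z + c))
    (h2 : y * (y ^ 2 - 3 * y + c) = z * (z ^ 2 - 3 * z + c)) :
    x + y + z = 3 ∧ 3 * z ^ 2 - 6 * z + c = (z - x) * (z - y) := by
  have k1 : x ^ 2 + x * z + z ^ 2 - 3 * (x + z) + c = 0 :=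
    mul_left_cancel₀ (sub_ne_zero.2 hxz) (by linear_combination h1)
  have k2 : y ^ 2 + y * z + z ^ 2 - 3 * (y + z) + c = 0 :=
    mul_left_cancel₀ (sub_ne_zero.2 hyz) (by linear_combination h2)
  have k3 : x + y + z = 3 :=
    mul_left_cancel₀ (sub_ne_zero.2 hxy) (by linear_combination k1 - k2)
  exact ⟨k3, by linear_combination k2 - (y - z) * k3⟩

/-- The moment system `∑ bᵢ = ∑ xᵢ bᵢ = 0`, `∑ (xᵢ² + s xᵢ + t) bᵢ = α` is solved by divided
difference weights. -/
lemma divided_difference_system_iff {x y z s t α b1 b2 b3 : ℝ}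
    (hxy : y - x ≠ 0) (hyz : z - y ≠ 0) (hxz : z - x ≠ 0) :
    ((x ^ 2 + s * x + t) * b1 + (y ^ 2 + s * y + t) * b2 + (z ^ 2 + s * z + t) * b3 = α ∧
        x * b1 + y * b2 + z * b3 = 0 ∧ b1 + b2 + b3 = 0) ↔
      (b3 = α / ((z - x) * (z - y)) ∧ b1 = (z - y) / (y - x) * b3 ∧
        b2 = (x - z) / (y - x) * b3) := by
  constructor
  · rintro ⟨h1, h2, h3⟩
    refine ⟨?_, ?_, ?_⟩
    · field_simp
      linear_combination h1 - (s + x + y) * h2 + (x * y - t) * h3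
    · field_simp
      linear_combination y * h3 - h2
    · field_simp
      linear_combination h2 - x * h3
  · rintro ⟨h3, h1, h2⟩
    rw [eq_div_iff (mul_ne_zero hxz hyz)] at h3
    subst h1 h2
    refine ⟨?_, ?_, ?_⟩
    · rw [← h3]
      field_simp
      ring
    · field_simp
      ring
    · field_simp
      ring

/-- The linear system determining the weights: `(α₁,α₂,α₃)` is a solution iff it is given
by the stated explicit formulas. -/
theorem stmt10 (p : ℝ) (hp0 : 0 < p) (hp1 : p < 1)
    (lam1 lam2 lam3 lam : ℝ) (h12 : lam1 < lam2) (h23 : lam2 < lam3)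
    (h1a : lam1 ≠ 1 - p) (h1b : lam1 ≠ 1 + p)
    (h2a : lam2 ≠ 1 - p) (h2b : lam2 ≠ 1 + p)
    (h3a : lam3 ≠ 1 - p) (h3b : lam3 ≠ 1 + p)
    (hR1 : R p lam1 = lam) (hR2 : R p lam2 = lam) (hR3 : R p lam3 = lam)
    (α : ℝ) :
    ∀ a1 a2 a3 : ℝ,
      (a1 + a2 + a3 = α ∧
        (1 - p) * (1 - lam1) * a1 / ((1 - p - lam1) * (1 + p - lam1)) +
          (1 - p) * (1 - lam2) * a2 / ((1 - p - lam2) * (1 + p - lam2)) +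
          (1 - p) * (1 - lam3) * a3 / ((1 - p - lam3) * (1 + p - lam3)) = 0 ∧
        p * (1 - p) * a1 / ((1 - p - lam1) * (1 + p - lam1)) +
          p * (1 - p) * a2 / ((1 - p - lam2) * (1 + p - lam2)) +
          p * (1 - p) * a3 / ((1 - p - lam3) * (1 + p - lam3)) = 0) ↔
      (a3 = (1 + p - lam3) * ((1 - p) - lam3) * α /
              (3 * lam3 ^ 2 - 6 * lam3 + 2 + p * (1 - p)) ∧
        a1 = (lam3 - lam2) * ((1 - p) - lam1) * (1 + p - lam1) /
              ((lam2 - lam1) * ((1 - p) - lam3) * (1 + p - lam3)) * a3 ∧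
        a2 = (lam1 - lam3) * ((1 - p) - lam2) * (1 + p - lam2) /
              ((lam2 - lam1) * ((1 - p) - lam3) * (1 + p - lam3)) * a3) := by
  have hp : p ≠ 0 := hp0.ne'
  have hq : 1 - p ≠ 0 := (sub_pos.2 hp1).ne'
  have hpq : p * (1 - p) ≠ 0 := mul_ne_zero hp hq
  obtain ⟨-, hD⟩ := vieta_of_cubic_eq (c := 2 + p * (1 - p)) h12.ne h23.ne (h12.trans h23).ne
    (by have h := hR1.trans hR3.symm
        rw [R, R, div_left_inj' hpq] at h
        linear_combination h)
    (by have h := hR2.trans hR3.symm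
        rw [R, R, div_left_inj' hpq] at h
        linear_combination h)
  rw [← add_assoc] at hD
  rw [hD]
  have d12 : lam2 - lam1 ≠ 0 := (sub_pos.2 h12).ne'
  have d23 : lam3 - lam2 ≠ 0 := (sub_pos.2 h23).ne'
  have d13 : lam3 - lam1 ≠ 0 := (sub_pos.2 (h12.trans h23)).ne'
  have u1 : 1 - p - lam1 ≠ 0 := sub_ne_zero.2 h1a.symm
  have u2 : 1 - p - lam2 ≠ 0 := sub_ne_zero.2 h2a.symm
  have u3 : 1 - p - lam3 ≠ 0 := sub_ne_zero.2 h3a.symm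
  have v1 : 1 + p - lam1 ≠ 0 := sub_ne_zero.2 h1b.symm
  have v2 : 1 + p - lam2 ≠ 0 := sub_ne_zero.2 h2b.symm
  have v3 : 1 + p - lam3 ≠ 0 := sub_ne_zero.2 h3b.symm
  intro a1 a2 a3
  obtain ⟨b1, rfl⟩ : ∃ b, a1 = (1 - p - lam1) * (1 + p - lam1) * b :=
    ⟨_, (mul_div_cancel₀ a1 (mul_ne_zero u1 v1)).symm⟩
  obtain ⟨b2, rfl⟩ : ∃ b, a2 = (1 - p - lam2) * (1 + p - lam2) * b :=
    ⟨_, (mul_div_cancel₀ a2 (mul_ne_zero u2 v2)).symm⟩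
  obtain ⟨b3, rfl⟩ : ∃ b, a3 = (1 - p - lam3) * (1 + p - lam3) * b :=
    ⟨_, (mul_div_cancel₀ a3 (mul_ne_zero u3 v3)).symm⟩
  have cancel {k l b : ℝ} (u : 1 - p - l ≠ 0) (v : 1 + p - l ≠ 0) :
      k * ((1 - p - l) * (1 + p - l) * b) / ((1 - p - l) * (1 + p - l)) = k * b := by
    field_simp
  rw [cancel u1 v1, cancel u2 v2, cancel u3 v3, cancel u1 v1, cancel u2 v2, cancel u3 v3]
  have key := divided_difference_system_iff (s := -2) (t := (1 - p) * (1 + p)) (α := α)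
    (b1 := b1) (b2 := b2) (b3 := b3) d12 d23 d13
  have weights {l m b : ℝ} (u : 1 - p - l ≠ 0) (v : 1 + p - l ≠ 0) :
      (1 - p - l) * (1 + p - l) * b = m * (1 - p - l) * (1 + p - l) /
        ((lam2 - lam1) * (1 - p - lam3) * (1 + p - lam3)) *
          ((1 - p - lam3) * (1 + p - lam3) * b3) ↔ b = m / (lam2 - lam1) * b3 := by
    rw [← mul_right_inj' (mul_ne_zero u v) (b := b)]
    refine Eq.congr_right ?_
    field_simp
  rw [weights u1 v1, weights u2 v2]
  have last : (1 - p - lam3) * (1 + p - lam3) * b3 =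
      (1 + p - lam3) * (1 - p - lam3) * α / ((lam3 - lam1) * (lam3 - lam2)) ↔
      b3 = α / ((lam3 - lam1) * (lam3 - lam2)) := by
    rw [← mul_right_inj' (mul_ne_zero u3 v3) (b := b3)]
    refine Eq.congr_right ?_
    ring
  rw [last, ← key]
  constructor
  · rintro ⟨h1, h2, h3⟩
    have h3' : b1 + b2 + b3 = 0 := mul_left_cancel₀ hpq (by linear_combination h3)
    exact ⟨by linear_combination h1,
      mul_left_cancel₀ hq (by linear_combination (1 - p) * h3' - h2), h3'⟩
  · rintro ⟨h1, h2, h3⟩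
    exact ⟨by linear_combination h1, by linear_combination (1 - p) * (h3 - h2),
      by linear_combination p * (1 - p) * h3⟩
end
end

section
/- Let λ ∈ (0, 2). Then the equation R(z) = λ has exactly three real roots λ_1 < λ_2 < λ_3 (and the cubic has no non-real roots), and they satisfy λ_1 ∈ (0, min(p,q)), λ_2 ∈ (max(p,q), 1 + min(p,q)), and λ_3 ∈ (1 + max(p,q), 2). -/
noncomputable section

/-- A monic cubic with three distinct roots factors, expressed through Vieta's formulas. -/
theorem vieta_of_three_roots {K : Type*} [Field K] {a b c x y z : K}
    (hxy : x ≠ y) (hyz : y ≠ z) (hxz : x ≠ z)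
    (hx : x ^ 3 + a * x ^ 2 + b * x + c = 0)
    (hy : y ^ 3 + a * y ^ 2 + b * y + c = 0)
    (hz : z ^ 3 + a * z ^ 2 + b * z + c = 0) :
    a = -(x + y + z) ∧ b = x * y + y * z + x * z ∧ c = -(x * y * z) := by
  have hxy' : x ^ 2 + x * y + y ^ 2 + a * (x + y) + b = 0 :=
    mul_left_cancel₀ (sub_ne_zero.2 hxy) (by linear_combination hx - hy)
  have hyz' : y ^ 2 + y * z + z ^ 2 + a * (y + z) + b = 0 :=
    mul_left_cancel₀ (sub_ne_zero.2 hyz) (by linear_combination hy - hz)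
  have ha : a + (x + y + z) = 0 :=
    mul_left_cancel₀ (sub_ne_zero.2 hxz) (by linear_combination hxy' - hyz')
  refine ⟨by linear_combination ha, by linear_combination hxy' - (x + y) * ha, ?_⟩
  linear_combination hx - x * hxy' + x * y * ha

theorem R_eq_iff {p : ℝ} (hp0 : 0 < p) (hp1 : p < 1) {z lam : ℝ} :
    R p z = lam ↔
      z ^ 3 + (-3) * z ^ 2 + (2 + p * (1 - p)) * z + -(lam * (p * (1 - p))) = 0 := by
  have hpq : p * (1 - p) ≠ 0 := (mul_pos hp0 (sub_pos.2 hp1)).ne'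
  rw [R, div_eq_iff hpq, ← sub_eq_zero]
  ring_nf

theorem continuous_R (p : ℝ) : Continuous (R p) := by
  unfold R
  fun_prop

/-- For `λ ∈ (0,2)`, the equation `R(z) = λ` has exactly three roots, all of them real,
with `λ₁ ∈ (0, min(p,q))`, `λ₂ ∈ (max(p,q), 1 + min(p,q))`, `λ₃ ∈ (1 + max(p,q), 2)`. -/
theorem stmt11 (p : ℝ) (hp0 : 0 < p) (hp1 : p < 1)
    (lam : ℝ) (hlam : lam ∈ Set.Ioo (0 : ℝ) 2) :
    ∃ l1 l2 l3 : ℝ, l1 < l2 ∧ l2 < l3 ∧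
      l1 ∈ Set.Ioo 0 (min p (1 - p)) ∧
      l2 ∈ Set.Ioo (max p (1 - p)) (1 + min p (1 - p)) ∧
      l3 ∈ Set.Ioo (1 + max p (1 - p)) 2 ∧
      ∀ w : ℂ,
        w * (w ^ 2 - 3 * w + 2 + (p : ℂ) * (1 - (p : ℂ))) / ((p : ℂ) * (1 - (p : ℂ))) =
            (lam : ℂ) ↔
          (w = (l1 : ℂ) ∨ w = (l2 : ℂ) ∨ w = (l3 : ℂ)) := by
  have hzero : R p 0 = 0 := (R_eq_iff hp0 hp1).2 (by ring)
  have htwo : R p 2 = 2 := (R_eq_iff hp0 hp1).2 (by ring)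
  have hmin : R p (min p (1 - p)) = 2 := by
    rcases min_choice p (1 - p) with h | h <;> rw [h, R_eq_iff hp0 hp1] <;> ring
  have hmax : R p (max p (1 - p)) = 2 := by
    rcases max_choice p (1 - p) with h | h <;> rw [h, R_eq_iff hp0 hp1] <;> ring
  have hmin' : R p (1 + min p (1 - p)) = 0 := by
    rcases min_choice p (1 - p) with h | h <;> rw [h, R_eq_iff hp0 hp1] <;> ring
  have hmax' : R p (1 + max p (1 - p)) = 0 := by
    rcases max_choice p (1 - p) with h | h <;> rw [h, R_eq_iff hp0 hp1] <;> ring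
  have hmin_pos : 0 < min p (1 - p) := lt_min hp0 (sub_pos.2 hp1)
  have hmax_lt : max p (1 - p) < 1 := max_lt hp1 (by linarith)
  have hmin_le : min p (1 - p) ≤ max p (1 - p) := min_le_max
  obtain ⟨l1, hl1, h1⟩ := intermediate_value_Ioo hmin_pos.le
    (continuous_R p).continuousOn (by rwa [hzero, hmin])
  obtain ⟨l2, hl2, h2⟩ := intermediate_value_Ioo'
    (show max p (1 - p) ≤ 1 + min p (1 - p) by linarith)
    (continuous_R p).continuousOn (by rwa [hmin', hmax])
  obtain ⟨l3, hl3, h3⟩ := intermediate_value_Ioo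
    (show 1 + max p (1 - p) ≤ 2 by linarith)
    (continuous_R p).continuousOn (by rwa [hmax', htwo])
  have h12 : l1 < l2 := by linarith [hl1.2, hl2.1]
  have h23 : l2 < l3 := by linarith [hl2.2, hl3.1]
  refine ⟨l1, l2, l3, h12, h23, hl1, hl2, hl3, fun w => ?_⟩
  obtain ⟨ha, hb, hc⟩ := vieta_of_three_roots h12.ne h23.ne (h12.trans h23).ne
    ((R_eq_iff hp0 hp1).1 h1) ((R_eq_iff hp0 hp1).1 h2) ((R_eq_iff hp0 hp1).1 h3)
  have ha' : (-3 : ℂ) = -(l1 + l2 + l3) := by exact_mod_cast ha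
  have hb' : (2 : ℂ) + p * (1 - p) = l1 * l2 + l2 * l3 + l1 * l3 := by exact_mod_cast hb
  have hc' : -((lam : ℂ) * (p * (1 - p))) = -(l1 * l2 * l3) := by exact_mod_cast hc
  have hpq : (p : ℂ) * (1 - p) ≠ 0 := by
    exact_mod_cast (mul_pos hp0 (sub_pos.2 hp1)).ne'
  have hfactor : w * (w ^ 2 - 3 * w + 2 + (p : ℂ) * (1 - p)) - lam * (p * (1 - p)) =
      (w - l1) * ((w - l2) * (w - l3)) := by
    linear_combination w ^ 2 * ha' + w * hb' + hc'
  rw [div_eq_iff hpq, ← sub_eq_zero, hfactor, mul_eq_zero, mul_eq_zero, sub_eq_zero,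
    sub_eq_zero, sub_eq_zero]
end
end

section
/- Let λ ∈ (0, 2) and let λ_1 < λ_2 < λ_3 be the three real roots of R(z) = λ (which satisfy λ_1 ∈ (0, min(p,q)), λ_2 ∈ (max(p,q), 1 + min(p,q)), λ_3 ∈ (1 + max(p,q), 2)). If α ≥ 0, then the unique solution (α_1, α_2, α_3) of the system α_1 + α_2 + α_3 = α, Σ_{i=1}^3 q(1−λ_i)·α_i/((1−p−λ_i)(1+p−λ_i)) = 0, Σ_{i=1}^3 pq·α_i/((1−p−λ_i)(1+p−λ_i)) = 0 satisfies α_1 ≥ 0, α_2 ≥ 0, and α_3 ≥ 0. -/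
noncomputable section

/-- Weights on three nodes whose moments of order `0`, `1`, `2` are `0`, `0`, `m` are, up to the
factor `m`, the leading coefficients of the Lagrange basis polynomials. -/
theorem lagrange_weights {x1 x2 x3 b1 b2 b3 m : ℝ} (h0 : b1 + b2 + b3 = 0)
    (h1 : x1 * b1 + x2 * b2 + x3 * b3 = 0)
    (h2 : x1 ^ 2 * b1 + x2 ^ 2 * b2 + x3 ^ 2 * b3 = m) :
    (x1 - x2) * (x1 - x3) * b1 = m ∧ (x2 - x1) * (x2 - x3) * b2 = m ∧
      (x3 - x1) * (x3 - x2) * b3 = m := by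
  refine ⟨?_, ?_, ?_⟩
  · linear_combination h2 - (x2 + x3) * h1 + x2 * x3 * h0
  · linear_combination h2 - (x1 + x3) * h1 + x1 * x3 * h0
  · linear_combination h2 - (x1 + x2) * h1 + x1 * x2 * h0

/-- If `α ≥ 0`, then the solution `(α₁,α₂,α₃)` of the weight system is nonnegative. -/
theorem stmt12 (p : ℝ) (hp0 : 0 < p) (hp1 : p < 1)
    (lam : ℝ) (hlam : lam ∈ Set.Ioo (0 : ℝ) 2)
    (lam1 lam2 lam3 : ℝ) (h12 : lam1 < lam2) (h23 : lam2 < lam3)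
    (hR1 : R p lam1 = lam) (hR2 : R p lam2 = lam) (hR3 : R p lam3 = lam)
    (hmem1 : lam1 ∈ Set.Ioo 0 (min p (1 - p)))
    (hmem2 : lam2 ∈ Set.Ioo (max p (1 - p)) (1 + min p (1 - p)))
    (hmem3 : lam3 ∈ Set.Ioo (1 + max p (1 - p)) 2)
    (α : ℝ) (hα : 0 ≤ α)
    (a1 a2 a3 : ℝ)
    (hsum : a1 + a2 + a3 = α)
    (heq2 : (1 - p) * (1 - lam1) * a1 / ((1 - p - lam1) * (1 + p - lam1)) +
        (1 - p) * (1 - lam2) * a2 / ((1 - p - lam2) * (1 + p - lam2)) +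
        (1 - p) * (1 - lam3) * a3 / ((1 - p - lam3) * (1 + p - lam3)) = 0)
    (heq3 : p * (1 - p) * a1 / ((1 - p - lam1) * (1 + p - lam1)) +
        p * (1 - p) * a2 / ((1 - p - lam2) * (1 + p - lam2)) +
        p * (1 - p) * a3 / ((1 - p - lam3) * (1 + p - lam3)) = 0) :
    0 ≤ a1 ∧ 0 ≤ a2 ∧ 0 ≤ a3 := by
  rw [Set.mem_Ioo, lt_min_iff] at hmem1
  rw [Set.mem_Ioo, max_lt_iff, ← sub_lt_iff_lt_add', lt_min_iff] at hmem2
  rw [Set.mem_Ioo, ← lt_sub_iff_add_lt', max_lt_iff] at hmem3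
  have hD1 : 0 < (1 - p - lam1) * (1 + p - lam1) := by
    apply mul_pos <;> linarith
  have hD2 : (1 - p - lam2) * (1 + p - lam2) < 0 := by
    apply mul_neg_of_neg_of_pos <;> linarith
  have hD3 : 0 < (1 - p - lam3) * (1 + p - lam3) := by
    apply mul_pos_of_neg_of_neg <;> linarith
  obtain ⟨b1, rfl⟩ : ∃ b, a1 = (1 - p - lam1) * (1 + p - lam1) * b :=
    ⟨_, (mul_div_cancel₀ a1 hD1.ne').symm⟩
  obtain ⟨b2, rfl⟩ : ∃ b, a2 = (1 - p - lam2) * (1 + p - lam2) * b :=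
    ⟨_, (mul_div_cancel₀ a2 hD2.ne).symm⟩
  obtain ⟨b3, rfl⟩ : ∃ b, a3 = (1 - p - lam3) * (1 + p - lam3) * b :=
    ⟨_, (mul_div_cancel₀ a3 hD3.ne').symm⟩
  have cancel {D : ℝ} (hD : D ≠ 0) (c b : ℝ) : c * (D * b) / D = c * b := by
    rw [mul_div_assoc, mul_div_cancel_left₀ b hD]
  rw [cancel hD1.ne', cancel hD2.ne, cancel hD3.ne'] at heq2 heq3
  have hq : 0 < 1 - p := sub_pos.mpr hp1
  have h0 : b1 + b2 + b3 = 0 := by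
    apply (mul_eq_zero_iff_left (mul_pos hp0 hq).ne').mp
    linear_combination heq3
  have h1 : lam1 * b1 + lam2 * b2 + lam3 * b3 = 0 := by
    have h : (1 - lam1) * b1 + (1 - lam2) * b2 + (1 - lam3) * b3 = 0 := by
      apply (mul_eq_zero_iff_left hq.ne').mp
      linear_combination heq2
    linear_combination h0 - h
  have h2 : lam1 ^ 2 * b1 + lam2 ^ 2 * b2 + lam3 ^ 2 * b3 = α := by
    linear_combination hsum + 2 * h1 - (1 - p ^ 2) * h0
  obtain ⟨e1, e2, e3⟩ := lagrange_weights h0 h1 h2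
  have hb1 : 0 ≤ b1 := nonneg_of_mul_nonneg_right (e1.symm ▸ hα)
    (mul_pos_of_neg_of_neg (by linarith) (by linarith))
  have hb2 : b2 ≤ 0 := by
    have h : (lam2 - lam1) * (lam2 - lam3) < 0 :=
      mul_neg_of_pos_of_neg (by linarith) (by linarith)
    by_contra! hb
    linarith [mul_neg_of_neg_of_pos h hb]
  have hb3 : 0 ≤ b3 := nonneg_of_mul_nonneg_right (e3.symm ▸ hα)
    (mul_pos (by linarith) (by linarith))
  exact ⟨mul_nonneg hD1.le hb1, mul_nonneg_of_nonpos_of_nonpos hD2.le hb2,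
    mul_nonneg hD3.le hb3⟩
end
end

section
/- For every z ∈ [0, 2], the limit lim_{n→∞} ((2+pq)/(pq))^n · φ^{∘n}(z) exists as a finite real number, where φ^{∘n} denotes the n-fold iterate of φ. (Note (2+pq)/(pq) = R'(0).) -/
noncomputable section

/-- One step of the inverse branch: the multiplier `(2 + pq)/(pq)` overshoots on `w`
and undershoots on `w * (1 + 4 * w)`. -/
theorem R_preimage_bounds {p w z : ℝ} (hp0 : 0 < p) (hp1 : p < 1)
    (hw : w ∈ Set.Icc 0 (min p (1 - p))) (h : R p w = z) :
    w ≤ 1 / 2 ∧ z ≤ (2 + p * (1 - p)) / (p * (1 - p)) * w ∧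
      (2 + p * (1 - p)) / (p * (1 - p)) * (w * (1 + 4 * w)) ≤ z * (1 + 4 * z) := by
  obtain ⟨hw0, hw1⟩ := hw
  have hwp := hw1.trans (min_le_left _ _)
  have hwq := hw1.trans (min_le_right _ _)
  have hw2 : w ≤ 1 / 2 := by linarith
  have hm : 0 < p * (1 - p) := mul_pos hp0 (by linarith)
  have hm4 : p * (1 - p) ≤ 1 / 4 := by nlinarith [sq_nonneg (p - 1 / 2)]
  unfold R at h
  generalize p * (1 - p) = m at *
  have hz : z * m = w * (w ^ 2 - 3 * w + 2 + m) := by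
    rw [← h]; field_simp
  have hs : 3 / 4 ≤ w ^ 2 - 3 * w + 2 := by nlinarith
  have hz4 : 4 * w ≤ z := by
    refine le_of_mul_le_mul_right ?_ hm
    rw [hz]
    nlinarith [mul_nonneg hw0 (sub_nonneg.2 hs), mul_nonneg hw0 (sub_nonneg.2 hm4)]
  refine ⟨hw2, ?_, ?_⟩
  · rw [div_mul_eq_mul_div, le_div_iff₀ hm, hz]
    nlinarith [mul_nonneg hw0 (mul_nonneg hw0 (by linarith : 0 ≤ 3 - w))]
  · rw [div_mul_eq_mul_div, div_le_iff₀ hm]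
    have hcubic : 2 * (1 + 4 * w) ≤ (w ^ 2 - 3 * w + 2) * (1 + 16 * w) := by
      have : 0 ≤ w * (21 - 47 * w + 16 * w ^ 2) := mul_nonneg hw0 (by nlinarith)
      linarith
    calc (2 + m) * (w * (1 + 4 * w)) = w * (2 * (1 + 4 * w) + m * (1 + 4 * w)) := by ring
      _ ≤ w * ((w ^ 2 - 3 * w + 2) * (1 + 16 * w) + m * (1 + 16 * w)) := by
        gcongr
        linarith
      _ = w * (w ^ 2 - 3 * w + 2 + m) * (1 + 4 * (4 * w)) := by ring
      _ ≤ w * (w ^ 2 - 3 * w + 2 + m) * (1 + 4 * z) := by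
        have : 0 ≤ w * (w ^ 2 - 3 * w + 2 + m) := mul_nonneg hw0 (by linarith)
        gcongr
      _ = z * (1 + 4 * z) * m := by rw [← hz]; ring

/-- For every `z ∈ [0,2]`, the limit `lim_{n→∞} ((2+pq)/(pq))ⁿ · φ^[n](z)` exists, where `φ`
is the lowest branch of `R⁻¹` and `(2+pq)/(pq) = R'(0)`. -/
theorem stmt13 (p : ℝ) (hp0 : 0 < p) (hp1 : p < 1)
    (φ : ℝ → ℝ)
    (hφmem : ∀ z ∈ Set.Icc (0 : ℝ) 2, φ z ∈ Set.Icc 0 (min p (1 - p)))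
    (hφinv : ∀ z ∈ Set.Icc (0 : ℝ) 2, R p (φ z) = z) :
    ∀ z ∈ Set.Icc (0 : ℝ) 2, ∃ L : ℝ,
      Filter.Tendsto (fun n => ((2 + p * (1 - p)) / (p * (1 - p))) ^ n * φ^[n] z)
        Filter.atTop (nhds L) := by
  intro z hz
  have key := fun x hx => R_preimage_bounds hp0 hp1 (hφmem x hx) (hφinv x hx)
  have hm : 0 < p * (1 - p) := mul_pos hp0 (by linarith)
  have hl : 0 ≤ (2 + p * (1 - p)) / (p * (1 - p)) := by positivity
  generalize (2 + p * (1 - p)) / (p * (1 - p)) = l at *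
  have hmem : ∀ n, φ^[n] z ∈ Set.Icc (0 : ℝ) 2 := by
    intro n
    induction n with
    | zero => exact hz
    | succ n ih =>
      rw [Function.iterate_succ_apply']
      exact ⟨(hφmem _ ih).1, (key _ ih).1.trans (by norm_num)⟩
  have hmono : Monotone fun n => l ^ n * φ^[n] z := by
    refine monotone_nat_of_le_succ fun n => ?_
    rw [Function.iterate_succ_apply', pow_succ, mul_assoc]
    exact mul_le_mul_of_nonneg_left (key _ (hmem n)).2.1 (pow_nonneg hl n)
  have hanti : Antitone fun n => l ^ n * (φ^[n] z * (1 + 4 * φ^[n] z)) := by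
    refine antitone_nat_of_succ_le fun n => ?_
    rw [Function.iterate_succ_apply', pow_succ, mul_assoc]
    exact mul_le_mul_of_nonneg_left (key _ (hmem n)).2.2 (pow_nonneg hl n)
  refine ⟨_, tendsto_atTop_ciSup hmono ⟨l ^ 0 * (φ^[0] z * (1 + 4 * φ^[0] z)), ?_⟩⟩
  rintro _ ⟨n, rfl⟩
  refine le_trans (mul_le_mul_of_nonneg_left ?_ (pow_nonneg hl n)) (hanti (Nat.zero_le n))
  nlinarith [sq_nonneg (φ^[n] z)]
end
end

section
/- Assume 0 < p < 1/2. For every z ∈ [0, 2], the limit L(z) := lim_{n→∞} ((2+pq)/(pq))^n · φ^{∘n}(z) satisfies z·(1 + (3pq/(2+pq)^2)·z) ≤ L(z) ≤ z·exp( z·p(2+q)/(2q(2−p)) ). -/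
noncomputable section

theorem R_le_mul {p w : ℝ} (hp0 : 0 < p) (hp : p < 1) (hw0 : 0 ≤ w) (hwp : w ≤ p) :
    R p w ≤ (2 + p * (1 - p)) / (p * (1 - p)) * w := by
  have hs : 0 < p * (1 - p) := mul_pos hp0 (by linarith)
  rw [R, div_mul_eq_mul_div]
  refine div_le_div_of_nonneg_right ?_ hs.le
  nlinarith [mul_nonneg (mul_nonneg hw0 hw0) (by linarith : 0 ≤ 3 - w)]

theorem R_mul_one_add_le {p w : ℝ} (hp0 : 0 < p) (hp : p < 1 / 2) (hw0 : 0 ≤ w) (hwp : w ≤ p) :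
    R p w * (1 + 3 * (p * (1 - p)) / (2 + p * (1 - p)) ^ 2 * R p w) ≤
      (2 + p * (1 - p)) / (p * (1 - p)) * w := by
  have hs : 0 < p * (1 - p) := mul_pos hp0 (by linarith)
  have hs' : p * (1 - p) ≤ 1 / 4 := by nlinarith [sq_nonneg (p - 1 / 2)]
  unfold R
  generalize p * (1 - p) = s at *
  have key : 0 ≤ 6 * (2 + s) * (3 - w) - (2 + s) ^ 2 - 3 * w * (3 - w) ^ 2 := by
    have h1 : w * (3 - w) ^ 2 ≤ 9 / 2 := by nlinarith [mul_nonneg hw0 hw0]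
    nlinarith
  have hD : 0 ≤ w ^ 2 - 3 * w + 2 + s := by nlinarith
  rw [← sub_nonneg]
  have : (2 + s) / s * w - w * (w ^ 2 - 3 * w + 2 + s) / s *
      (1 + 3 * s / (2 + s) ^ 2 * (w * (w ^ 2 - 3 * w + 2 + s) / s)) =
      w ^ 3 * (6 * (2 + s) * (3 - w) - (2 + s) ^ 2 - 3 * w * (3 - w) ^ 2) / (s * (2 + s) ^ 2) := by
    field_simp
    ring
  rw [this]
  positivity

theorem mul_le_R_mul_exp {p w : ℝ} (hp0 : 0 < p) (hp : p < 1) (hw0 : 0 ≤ w) (hwp : w ≤ p) :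
    (2 + p * (1 - p)) / (p * (1 - p)) * w ≤
      R p w * Real.exp ((p * (2 + (1 - p)) / (2 * (1 - p) * (2 - p))) * (R p w - w)) := by
  have hq : 0 < 1 - p := by linarith
  have hq' : 0 < 2 - p := by linarith
  have hs : 0 < p * (1 - p) := mul_pos hp0 hq
  have hE : 0 < (1 - w) * (2 - w) := mul_pos (by linarith) (by linarith)
  have hD : 0 < w ^ 2 - 3 * w + 2 + p * (1 - p) := by nlinarith
  have hR : 0 ≤ R p w := by unfold R; positivity
  have h1 : (3 - w) * ((1 - p) * (2 - p)) ≤ (3 - p) * ((1 - w) * (2 - w)) := by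
    nlinarith [mul_nonneg (sub_nonneg.2 hwp)
      (by nlinarith [mul_nonneg hw0 hp0.le] : 0 ≤ 7 - 3 * w - 3 * p + w * p)]
  have h2 : 2 * (1 - p) ≤ w ^ 2 - 3 * w + 2 + p * (1 - p) := by
    nlinarith [mul_nonneg (sub_nonneg.2 hwp) (by linarith : 0 ≤ 3 - p - w)]
  have h3 : (3 - w) * ((1 - p) * (2 - p)) * (2 * (1 - p)) ≤
      (3 - p) * ((1 - w) * (2 - w)) * (w ^ 2 - 3 * w + 2 + p * (1 - p)) :=
    mul_le_mul h1 h2 (by linarith) (mul_nonneg (by linarith) hE.le)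
  refine le_trans ?_ (mul_le_mul_of_nonneg_left (Real.add_one_le_exp _) hR)
  rw [← sub_nonneg]
  have : R p w * (p * (2 + (1 - p)) / (2 * (1 - p) * (2 - p)) * (R p w - w) + 1) -
      (2 + p * (1 - p)) / (p * (1 - p)) * w =
      w ^ 2 * ((3 - p) * ((1 - w) * (2 - w)) * (w ^ 2 - 3 * w + 2 + p * (1 - p)) -
        (3 - w) * ((1 - p) * (2 - p)) * (2 * (1 - p))) /
        (p * (1 - p) * ((1 - p) * (2 - p) * (2 * (1 - p)))) := by
    unfold R
    field_simp
    ring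
  rw [this]
  exact div_nonneg (mul_nonneg (sq_nonneg _) (sub_nonneg.2 h3)) (by positivity)

/-- For `0 < p < 1/2` and `z ∈ [0,2]`, the limit `L(z) = lim_n ((2+pq)/(pq))ⁿ φ^[n](z)`
satisfies `z(1 + (3pq/(2+pq)²)z) ≤ L(z) ≤ z·exp(z·p(2+q)/(2q(2−p)))`. -/
theorem stmt14 (p : ℝ) (hp0 : 0 < p) (hp : p < 1 / 2)
    (φ : ℝ → ℝ)
    (hφmem : ∀ z ∈ Set.Icc (0 : ℝ) 2, φ z ∈ Set.Icc 0 (min p (1 - p)))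
    (hφinv : ∀ z ∈ Set.Icc (0 : ℝ) 2, R p (φ z) = z) :
    ∀ z ∈ Set.Icc (0 : ℝ) 2, ∀ L : ℝ,
      Filter.Tendsto (fun n => ((2 + p * (1 - p)) / (p * (1 - p))) ^ n * φ^[n] z)
        Filter.atTop (nhds L) →
      z * (1 + 3 * (p * (1 - p)) / (2 + p * (1 - p)) ^ 2 * z) ≤ L ∧
      L ≤ z * Real.exp (z * (p * (2 + (1 - p)) / (2 * (1 - p) * (2 - p)))) := by
  intro z hz L hL
  set a := (2 + p * (1 - p)) / (p * (1 - p))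
  set k := p * (2 + (1 - p)) / (2 * (1 - p) * (2 - p)) with hk
  have hq : 0 < 1 - p := by linarith
  have hq' : 0 < 2 - p := by linarith
  have ha : 0 ≤ a := by positivity
  have hk0 : 0 ≤ k := by positivity
  have hφ : ∀ x ∈ Set.Icc (0 : ℝ) 2, 0 ≤ φ x ∧ φ x ≤ p := fun x hx =>
    ⟨(hφmem x hx).1, (hφmem x hx).2.trans (min_le_left _ _)⟩
  have hiter : ∀ n, φ^[n] z ∈ Set.Icc (0 : ℝ) 2 := by
    intro n
    induction n with
    | zero => exact hz
    | succ n ih =>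
      rw [Function.iterate_succ_apply']
      exact ⟨(hφ _ ih).1, by linarith [(hφ _ ih).2]⟩
  constructor
  · have hmono : Monotone fun n => a ^ n * φ^[n] z := by
      refine monotone_nat_of_le_succ fun n => ?_
      obtain ⟨h0, h1⟩ := hφ _ (hiter n)
      have h := R_le_mul hp0 (by linarith) h0 h1
      rw [hφinv _ (hiter n)] at h
      simp only [Function.iterate_succ_apply', pow_succ, mul_assoc]
      gcongr
    obtain ⟨h0, h1⟩ := hφ z hz
    have h := R_mul_one_add_le hp0 hp h0 h1
    rw [hφinv z hz] at h
    refine h.trans ?_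
    simpa using hmono.ge_of_tendsto hL 1
  · have hbound : ∀ n, a ^ n * (φ^[n] z * Real.exp (k * φ^[n] z)) ≤ z * Real.exp (k * z) := by
      intro n
      induction n with
      | zero => simp
      | succ n ih =>
        refine le_trans ?_ ih
        obtain ⟨h0, h1⟩ := hφ _ (hiter n)
        have h := mul_le_R_mul_exp hp0 (by linarith) h0 h1
        rw [hφinv _ (hiter n), ← hk] at h
        simp only [Function.iterate_succ_apply', pow_succ, mul_assoc]
        gcongr a ^ n * ?_
        calc a * (φ (φ^[n] z) * Real.exp (k * φ (φ^[n] z)))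
            = (a * φ (φ^[n] z)) * Real.exp (k * φ (φ^[n] z)) := by ring
          _ ≤ (φ^[n] z * Real.exp (k * (φ^[n] z - φ (φ^[n] z)))) *
                Real.exp (k * φ (φ^[n] z)) := by gcongr
          _ = φ^[n] z * Real.exp (k * φ^[n] z) := by
            rw [mul_assoc, ← Real.exp_add]
            ring_nf
    refine le_of_tendsto' hL fun n => ?_
    rw [mul_comm z k]
    refine le_trans ?_ (hbound n)
    have h0 := (hiter n).1
    gcongr
    exact le_mul_of_one_le_right h0 (Real.one_le_exp (by positivity))
end
end

section
/- Assume 0 < p < 1/2. For every z ∈ [0, 2], one has (pq/(2+pq))·z + (3(pq)^2/(2+pq)^3)·z^2 ≤ φ(z) ≤ (pq/(2+pq))·z·(1 + (p(2+q)/(4q))·z). -/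
noncomputable section

/-- For `0 < p < 1/2` and `z ∈ [0,2]`:
`(pq/(2+pq))z + (3(pq)²/(2+pq)³)z² ≤ φ(z) ≤ (pq/(2+pq))z(1 + (p(2+q)/(4q))z)`. -/
theorem stmt15 (p : ℝ) (hp0 : 0 < p) (hp : p < 1 / 2)
    (φ : ℝ → ℝ)
    (hφmem : ∀ z ∈ Set.Icc (0 : ℝ) 2, φ z ∈ Set.Icc 0 (min p (1 - p)))
    (hφinv : ∀ z ∈ Set.Icc (0 : ℝ) 2, R p (φ z) = z) :
    ∀ z ∈ Set.Icc (0 : ℝ) 2,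
      (p * (1 - p) / (2 + p * (1 - p))) * z +
          (3 * (p * (1 - p)) ^ 2 / (2 + p * (1 - p)) ^ 3) * z ^ 2 ≤ φ z ∧
      φ z ≤ (p * (1 - p) / (2 + p * (1 - p))) * z *
          (1 + (p * (2 + (1 - p)) / (4 * (1 - p))) * z) := by
  intro z hz
  obtain ⟨hw0, hwm⟩ := hφmem z hz
  have hwp : φ z ≤ p := hwm.trans (min_le_left _ _)
  have hR := hφinv z hz
  generalize φ z = w at *
  have hq : 0 < 1 - p := by linarith
  have ha : 0 < p * (1 - p) := mul_pos hp0 hq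
  have hz_eq : z = w * (w ^ 2 - 3 * w + (2 + p * (1 - p))) / (p * (1 - p)) := by
    rw [← hR, R]; ring
  obtain ⟨t, ht⟩ : ∃ t, t = w ^ 2 - 3 * w + (2 + p * (1 - p)) := ⟨_, rfl⟩
  rw [← ht] at hz_eq
  have ht_sub : t - 2 * (1 - p) = (p - w) * (3 - p - w) := by rw [ht]; ring
  have ht_ge : 2 * (1 - p) ≤ t := by
    have : 0 ≤ (p - w) * (3 - p - w) := mul_nonneg (by linarith) (by linarith)
    linarith
  constructor
  · obtain ⟨s, hs⟩ : ∃ s, s = 2 + p * (1 - p) := ⟨_, rfl⟩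
    have hs_le : s ≤ 5 / 2 := by nlinarith
    have hs0 : 0 < s := by linarith
    rw [← hs] at ht ⊢
    have ht_le : t ≤ s - 5 / 2 * w := by nlinarith
    have key : 3 * t ^ 2 ≤ s ^ 2 * (3 - w) := by
      have h₁ : t * t ≤ s * (s - 5 / 2 * w) :=
        mul_le_mul (by linarith) ht_le (by linarith) hs0.le
      have h₂ : 0 ≤ s * w * (15 / 2 - s) :=
        mul_nonneg (mul_nonneg hs0.le hw0) (by linarith)
      nlinarith
    have hdiff : w - (p * (1 - p) / s * z + 3 * (p * (1 - p)) ^ 2 / s ^ 3 * z ^ 2) =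
        w ^ 2 * (s ^ 2 * (3 - w) - 3 * t ^ 2) / s ^ 3 := by
      have hs' : s - t = w * (3 - w) := by rw [ht]; ring
      have hexp : w - (p * (1 - p) / s * z + 3 * (p * (1 - p)) ^ 2 / s ^ 3 * z ^ 2) =
          w * (s ^ 2 * (s - t) - 3 * w * t ^ 2) / s ^ 3 := by
        rw [hz_eq]; field_simp; ring
      rw [hexp, hs']; ring
    have : 0 ≤ w ^ 2 * (s ^ 2 * (3 - w) - 3 * t ^ 2) / s ^ 3 :=
      div_nonneg (mul_nonneg (sq_nonneg _) (by linarith)) (by positivity)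
    linarith
  · obtain ⟨s, hs⟩ : ∃ s, s = 2 + p * (1 - p) := ⟨_, rfl⟩
    have hs0 : 0 < s := by linarith
    rw [← hs] at ht ⊢
    have key : 4 * (1 - p) ^ 2 * (3 - w) ≤ (3 - p) * t ^ 2 := by
      have h₁ : 1 * (4 * (1 - p)) ≤ ((3 - p) * (3 - p - w)) * (t + 2 * (1 - p)) :=
        mul_le_mul (by nlinarith) (by linarith) (by linarith) (by nlinarith)
      have h₂ : 0 ≤ (p - w) * ((3 - p) * (3 - p - w) * (t + 2 * (1 - p)) - 4 * (1 - p) ^ 2) :=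
        mul_nonneg (by linarith) (by nlinarith)
      have h₃ : (3 - p) * t ^ 2 - 4 * (1 - p) ^ 2 * (3 - w) =
          (3 - p) * ((t - 2 * (1 - p)) * (t + 2 * (1 - p))) - 4 * (1 - p) ^ 2 * (p - w) := by
        ring
      rw [ht_sub] at h₃
      linarith
    have hdiff : p * (1 - p) / s * z * (1 + p * (2 + (1 - p)) / (4 * (1 - p)) * z) - w =
        w ^ 2 * ((3 - p) * t ^ 2 - 4 * (1 - p) ^ 2 * (3 - w)) / (4 * (1 - p) ^ 2 * s) := by
      have hs' : s - t = w * (3 - w) := by rw [ht]; ring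
      have hexp : p * (1 - p) / s * z * (1 + p * (2 + (1 - p)) / (4 * (1 - p)) * z) - w =
          w * ((3 - p) * w * t ^ 2 - 4 * (1 - p) ^ 2 * (s - t)) / (4 * (1 - p) ^ 2 * s) := by
        rw [hz_eq]; field_simp; ring
      rw [hexp, hs']; ring
    have : 0 ≤ w ^ 2 * ((3 - p) * t ^ 2 - 4 * (1 - p) ^ 2 * (3 - w)) / (4 * (1 - p) ^ 2 * s) :=
      div_nonneg (mul_nonneg (sq_nonneg _) (by linarith)) (by positivity)
    linarith
end
end

section
/- Assume 0 < p < 1/2. Then φ is three times differentiable on (0, 2), and its third derivative satisfies φ'''(z) > 0 for every z ∈ (0, 2). -/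
noncomputable section

theorem hasDerivAt_R (p y : ℝ) :
    HasDerivAt (R p) ((3 * y ^ 2 - 6 * y + 2 + p * (1 - p)) / (p * (1 - p))) y := by
  have h := hasDerivAt_id' y
  refine ((h.fun_mul ((((h.fun_pow 2).fun_sub (h.const_mul 3)).add_const 2).add_const
    (p * (1 - p)))).div_const (p * (1 - p))).congr_deriv ?_
  congr 1
  push_cast
  ring

/-- The secant slopes of `pq R` on `[0, p]` are at least its derivative at `p`. -/
theorem secant_lower_bound {p a b : ℝ} (hp : p ≤ 1 / 2) (hap : a ≤ p) (hbp : b ≤ p) :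
    (2 - p) * (1 - 2 * p) ≤
      a ^ 2 + a * b + b ^ 2 - 3 * (a + b) + 2 + p * (1 - p) := by
  nlinarith [mul_nonneg (sub_nonneg.2 hap) (sub_nonneg.2 hbp), sq_nonneg (p - a),
    sq_nonneg (p - b), mul_nonneg (sub_nonneg.2 hap) (sub_nonneg.2 hp),
    mul_nonneg (sub_nonneg.2 hbp) (sub_nonneg.2 hp)]

theorem continuousOn_of_R_rightInverse {p : ℝ} (hp0 : 0 < p) (hp : p < 1 / 2) {φ : ℝ → ℝ}
    {s : Set ℝ} (hmem : ∀ z ∈ s, 0 ≤ φ z ∧ φ z ≤ p) (hinv : ∀ z ∈ s, R p (φ z) = z) :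
    ContinuousOn φ s := by
  have hc : 0 < p * (1 - p) := mul_pos hp0 (by linarith)
  have hm : 0 < (2 - p) * (1 - 2 * p) := mul_pos (by linarith) (by linarith)
  refine (LipschitzOnWith.of_dist_le_mul
    (K := .mk (p * (1 - p) / ((2 - p) * (1 - 2 * p))) (div_pos hc hm).le) ?_).continuousOn
  intro x hx y hy
  obtain ⟨-, hap⟩ := hmem x hx
  obtain ⟨-, hbp⟩ := hmem y hy
  have hF := secant_lower_bound hp.le hap hbp
  have key : (φ x - φ y) * (φ x ^ 2 + φ x * φ y + φ y ^ 2 - 3 * (φ x + φ y) + 2 + p * (1 - p)) =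
      p * (1 - p) * (x - y) := by
    have hX := hinv x hx
    have hY := hinv y hy
    rw [R, div_eq_iff hc.ne'] at hX hY
    linear_combination hX - hY
  have habs := congrArg abs key
  rw [abs_mul, abs_mul, abs_of_pos hc, abs_of_pos (hm.trans_le hF)] at habs
  rw [Real.dist_eq, Real.dist_eq, NNReal.coe_mk, div_mul_eq_mul_div, le_div_iff₀ hm, ← habs]
  exact mul_le_mul_of_nonneg_left hF (abs_nonneg _)

/-- For `0 < p < 1/2`, the lowest branch `φ` of `R⁻¹` is three times differentiable on
`(0,2)` and `φ'''(z) > 0` there. -/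
theorem stmt16 (p : ℝ) (hp0 : 0 < p) (hp : p < 1 / 2)
    (φ : ℝ → ℝ)
    (hφmem : ∀ z ∈ Set.Icc (0 : ℝ) 2, φ z ∈ Set.Icc 0 (min p (1 - p)))
    (hφinv : ∀ z ∈ Set.Icc (0 : ℝ) 2, R p (φ z) = z) :
    DifferentiableOn ℝ φ (Set.Ioo 0 2) ∧
    DifferentiableOn ℝ (deriv φ) (Set.Ioo 0 2) ∧
    DifferentiableOn ℝ (deriv (deriv φ)) (Set.Ioo 0 2) ∧
    ∀ z ∈ Set.Ioo (0 : ℝ) 2, 0 < deriv (deriv (deriv φ)) z := by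
  have hc : 0 < p * (1 - p) := mul_pos hp0 (by linarith)
  have hmem : ∀ z ∈ Set.Icc (0 : ℝ) 2, 0 ≤ φ z ∧ φ z ≤ p := fun z hz =>
    ⟨(hφmem z hz).1, (hφmem z hz).2.trans (min_le_left _ _)⟩
  have hD : ∀ z ∈ Set.Ioo (0 : ℝ) 2, 0 < 3 * φ z ^ 2 - 6 * φ z + 2 + p * (1 - p) := by
    intro z hz
    obtain ⟨-, h1⟩ := hmem z (Set.Ioo_subset_Icc_self hz)
    have := secant_lower_bound hp.le h1 h1
    have : 0 < (2 - p) * (1 - 2 * p) := mul_pos (by linarith) (by linarith)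
    nlinarith
  have hcont : ContinuousOn φ (Set.Icc 0 2) := continuousOn_of_R_rightInverse hp0 hp hmem hφinv
  have h1 : ∀ z ∈ Set.Ioo (0 : ℝ) 2,
      HasDerivAt φ (p * (1 - p) / (3 * φ z ^ 2 - 6 * φ z + 2 + p * (1 - p))) z := by
    intro z hz
    have hz' : Set.Icc (0 : ℝ) 2 ∈ nhds z := Icc_mem_nhds hz.1 hz.2
    rw [← inv_div]
    refine HasDerivAt.of_local_left_inverse (hcont.continuousAt hz') (hasDerivAt_R p (φ z))
      (div_pos (hD z hz) hc).ne' ?_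
    filter_upwards [hz'] with w hw using hφinv w hw
  have e1 : ∀ z ∈ Set.Ioo (0 : ℝ) 2, deriv φ =ᶠ[nhds z]
      fun w => p * (1 - p) / (3 * φ w ^ 2 - 6 * φ w + 2 + p * (1 - p)) := by
    intro z hz
    filter_upwards [isOpen_Ioo.mem_nhds hz] with w hw using (h1 w hw).deriv
  have hDderiv : ∀ z ∈ Set.Ioo (0 : ℝ) 2,
      HasDerivAt (fun w => 3 * φ w ^ 2 - 6 * φ w + 2 + p * (1 - p))
        ((6 * φ z - 6) * (p * (1 - p) / (3 * φ z ^ 2 - 6 * φ z + 2 + p * (1 - p)))) z := by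
    intro z hz
    have h := h1 z hz
    refine (((((h.fun_pow 2).const_mul 3).fun_sub (h.const_mul 6)).add_const 2).add_const
      (p * (1 - p))).congr_deriv ?_
    push_cast
    ring
  have h2 : ∀ z ∈ Set.Ioo (0 : ℝ) 2, HasDerivAt (deriv φ)
      ((p * (1 - p)) ^ 2 * (6 - 6 * φ z) /
        (3 * φ z ^ 2 - 6 * φ z + 2 + p * (1 - p)) ^ 3) z := by
    intro z hz
    refine HasDerivAt.congr_of_eventuallyEq ?_ (e1 z hz)
    refine ((hasDerivAt_const z (p * (1 - p))).fun_div (hDderiv z hz) (hD z hz).ne').congr_deriv ?_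
    have hne := (hD z hz).ne'
    generalize 3 * φ z ^ 2 - 6 * φ z + 2 + p * (1 - p) = D at hne ⊢
    field_simp
    ring
  have e2 : ∀ z ∈ Set.Ioo (0 : ℝ) 2, deriv (deriv φ) =ᶠ[nhds z]
      fun w => (p * (1 - p)) ^ 2 * (6 - 6 * φ w) /
        (3 * φ w ^ 2 - 6 * φ w + 2 + p * (1 - p)) ^ 3 := by
    intro z hz
    filter_upwards [isOpen_Ioo.mem_nhds hz] with w hw using (h2 w hw).deriv
  have h3 : ∀ z ∈ Set.Ioo (0 : ℝ) 2, HasDerivAt (deriv (deriv φ))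
      ((p * (1 - p)) ^ 3 * (3 * (6 - 6 * φ z) ^ 2 -
        6 * (3 * φ z ^ 2 - 6 * φ z + 2 + p * (1 - p))) /
        (3 * φ z ^ 2 - 6 * φ z + 2 + p * (1 - p)) ^ 5) z := by
    intro z hz
    refine HasDerivAt.congr_of_eventuallyEq ?_ (e2 z hz)
    have hne := (hD z hz).ne'
    refine (((((h1 z hz).const_mul 6).const_sub 6).const_mul ((p * (1 - p)) ^ 2)).fun_div
      ((hDderiv z hz).fun_pow 3) (pow_ne_zero 3 hne)).congr_deriv ?_
    generalize 3 * φ z ^ 2 - 6 * φ z + 2 + p * (1 - p) = D at hne ⊢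
    field_simp
    ring
  refine ⟨fun z hz => (h1 z hz).differentiableAt.differentiableWithinAt,
    fun z hz => (h2 z hz).differentiableAt.differentiableWithinAt,
    fun z hz => (h3 z hz).differentiableAt.differentiableWithinAt, fun z hz => ?_⟩
  rw [(h3 z hz).deriv]
  refine div_pos (mul_pos (pow_pos hc 3) ?_) (pow_pos (hD z hz) 5)
  nlinarith [sq_nonneg (1 - φ z), sq_nonneg p]
end
end
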